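/- Let ℓ = 3, let A be an arrangement that is not free, and let H ∈ A. Then A' := A \ {H} is free with exponents (1, d_1, d_2) if and only if A is strictly plus-one generated with exponents (1, d_1+1, d_2+1) and level d = |A^H| − 1. -/

import Mathlib

open MvPolynomial

noncomputable section

attribute [local instance] Classical.propDecidable

namespace ArrPOG

variable (K : Type) [Field K] (ℓ : ℕ)

/-- A polynomial vector field on `K^ℓ`: `θ = Σ θᵢ ∂/∂xᵢ`, identified with its
coefficient vector `(θ₁,…,θ_ℓ)` in `S = K[x₁,…,x_ℓ]`. -/
abbrev Deriv : Type := Fin ℓ → MvPolynomial (Fin ℓ) K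

variable {K ℓ}

/-- The linear polynomial `α_H ∈ S` associated to a linear form `φ ∈ V*`. -/
def linPoly (φ : Module.Dual K (Fin ℓ → K)) : MvPolynomial (Fin ℓ) K :=
  ∑ i, MvPolynomial.C (φ (Pi.single i 1)) * MvPolynomial.X i

/-- `θ(α)` for a derivation `θ` and the linear form `α` given by `φ ∈ V*`. -/
def applyLin (θ : Deriv K ℓ) (φ : Module.Dual K (Fin ℓ → K)) : MvPolynomial (Fin ℓ) K :=
  ∑ i, MvPolynomial.C (φ (Pi.single i 1)) * θ i

/-- An arrangement: a finite set of hyperplanes (kernels of nonzero linear forms). -/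
def IsArrangement (A : Finset (Submodule K (Fin ℓ → K))) : Prop :=
  ∀ H ∈ A, ∃ φ : Module.Dual K (Fin ℓ → K), φ ≠ 0 ∧ LinearMap.ker φ = H

/-- Essential: the common intersection of all members is `0`. -/
def Essential (A : Finset (Submodule K (Fin ℓ → K))) : Prop :=
  A.inf id = ⊥

/-- Membership in the logarithmic derivation module `D(A)`:
`θ(α_H) ∈ S·α_H` for every `H ∈ A`. -/
def InD (A : Finset (Submodule K (Fin ℓ → K))) (θ : Deriv K ℓ) : Prop :=
  ∀ H ∈ A, ∀ φ : Module.Dual K (Fin ℓ → K), LinearMap.ker φ = H → linPoly φ ∣ applyLin θ φ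

/-- A derivation is homogeneous of degree `n` if all its coefficients are. -/
def HomogDeriv (θ : Deriv K ℓ) (n : ℕ) : Prop := ∀ i, (θ i).IsHomogeneous n

/-- `θ₁,…,θₙ` generate `D(A)` as an `S`-module. -/
def GeneratesD {n : ℕ} (A : Finset (Submodule K (Fin ℓ → K))) (θ : Fin n → Deriv K ℓ) : Prop :=
  (∀ i, InD A (θ i)) ∧
    ∀ η, InD A η → ∃ c : Fin n → MvPolynomial (Fin ℓ) K, η = ∑ i, c i • θ i

/-- `S`-linear independence of a family of derivations. -/
def IndepD {n : ℕ} (θ : Fin n → Deriv K ℓ) : Prop :=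
  ∀ c : Fin n → MvPolynomial (Fin ℓ) K, (∑ i, c i • θ i) = 0 → ∀ i, c i = 0

/-- `A` is free with exponents `e`: `D(A)` has a homogeneous basis of degrees `e i`. -/
def IsFreeExp (A : Finset (Submodule K (Fin ℓ → K))) (e : Fin ℓ → ℕ) : Prop :=
  ∃ θ : Fin ℓ → Deriv K ℓ, (∀ i, HomogDeriv (θ i) (e i)) ∧ GeneratesD A θ ∧ IndepD θ

/-- `A` is free. -/
def IsFree (A : Finset (Submodule K (Fin ℓ → K))) : Prop := ∃ e, IsFreeExp A e

/-- `A` is plus-one generated with exponents `e`, level `lev`, realized by the minimal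
homogeneous generators `θ₁,…,θ_ℓ, φ` whose unique syzygy is `Σ fᵢ•θᵢ + α•φ = 0`:
this encodes the minimal free resolution
`0 → S[-lev-1] → S[-lev] ⊕ (⊕ S[-eᵢ]) → D(A) → 0`. -/
def IsPOGWith (A : Finset (Submodule K (Fin ℓ → K))) (e : Fin ℓ → ℕ) (lev : ℕ)
    (θ : Fin ℓ → Deriv K ℓ) (φ : Deriv K ℓ)
    (f : Fin ℓ → MvPolynomial (Fin ℓ) K) (α : MvPolynomial (Fin ℓ) K) : Prop :=
  (∀ i, InD A (θ i)) ∧ InD A φ ∧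
  (∀ i, HomogDeriv (θ i) (e i)) ∧ HomogDeriv φ lev ∧
  (∀ η, InD A η → ∃ (c : Fin ℓ → MvPolynomial (Fin ℓ) K) (g : MvPolynomial (Fin ℓ) K),
      η = (∑ i, c i • θ i) + g • φ) ∧
  α.IsHomogeneous 1 ∧
  (∀ i, (f i).IsHomogeneous (lev + 1 - e i)) ∧
  (∀ i, MvPolynomial.constantCoeff (f i) = 0) ∧
  ((∑ i, f i • θ i) + α • φ = 0) ∧
  (¬ (α = 0 ∧ ∀ i, f i = 0)) ∧
  (∀ (g : Fin ℓ → MvPolynomial (Fin ℓ) K) (h : MvPolynomial (Fin ℓ) K),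
      ((∑ i, g i • θ i) + h • φ = 0) →
      ∃ q : MvPolynomial (Fin ℓ) K, (∀ i, g i = q * f i) ∧ h = q * α)

/-- Plus-one generated with exponents `e` and level `lev`. -/
def IsPOG (A : Finset (Submodule K (Fin ℓ → K))) (e : Fin ℓ → ℕ) (lev : ℕ) : Prop :=
  ∃ θ φ f α, IsPOGWith A e lev θ φ f α

/-- Strictly plus-one generated: the level coefficient `α` is nonzero. -/
def IsSPOG (A : Finset (Submodule K (Fin ℓ → K))) (e : Fin ℓ → ℕ) (lev : ℕ) : Prop :=
  ∃ θ φ f α, IsPOGWith A e lev θ φ f α ∧ α ≠ 0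

/-- The restriction `A^H = {L ⊓ H | L ∈ A \ {H}}`. -/
def restrict (A : Finset (Submodule K (Fin ℓ → K))) (H : Submodule K (Fin ℓ → K)) :
    Finset (Submodule K (Fin ℓ → K)) :=
  (A.erase H).image (fun L => L ⊓ H)

/-- The localization `A_X = {L ∈ A | X ⊆ L}`. -/
def localize (A : Finset (Submodule K (Fin ℓ → K))) (X : Submodule K (Fin ℓ → K)) :
    Finset (Submodule K (Fin ℓ → K)) :=
  A.filter (fun L => X ≤ L)

/-- The intersection lattice of `A`, inside the ambient space `T`. -/
def latticeOf (T : Submodule K (Fin ℓ → K)) (A : Finset (Submodule K (Fin ℓ → K))) :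
    Finset (Submodule K (Fin ℓ → K)) :=
  A.powerset.image (fun B => T ⊓ B.inf id)

/-- The Möbius function of the poset `L` (intersection lattice with top `T`). -/
def mob (T : Submodule K (Fin ℓ → K)) (L : Finset (Submodule K (Fin ℓ → K)))
    (X : Submodule K (Fin ℓ → K)) : ℤ :=
  if X = T then 1
  else - ∑ Y ∈ (L.filter fun Z => X < Z).attach, mob T L Y.1
termination_by (L.filter fun Z => X < Z).card
decreasing_by
  obtain ⟨Y, hY⟩ := Y
  simp only [Finset.mem_filter] at hY
  apply Finset.card_lt_card
  rw [Finset.ssubset_def]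
  constructor
  · intro Z hZ
    simp only [Finset.mem_filter] at hZ ⊢
    exact ⟨hZ.1, lt_trans hY.2 hZ.2⟩
  · intro hsub
    have h2 := hsub (Finset.mem_filter.mpr ⟨hY.1, hY.2⟩)
    simp only [Finset.mem_filter] at h2
    exact lt_irrefl Y h2.2

/-- The characteristic polynomial `χ(A;t) = Σ_{X ∈ L(A)} μ(X) t^{dim X}`
of an arrangement inside the ambient space `T`. -/
def charPoly (T : Submodule K (Fin ℓ → K)) (A : Finset (Submodule K (Fin ℓ → K))) :
    Polynomial ℤ :=
  ∑ X ∈ latticeOf T A,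
    Polynomial.C (mob T (latticeOf T A) X) * Polynomial.X ^ (Module.finrank K X)

/-- The Betti number `b_i(A)`: `χ(A;t) = Σ (-1)^i b_i(A) t^{ℓ-i}`. -/
def bNum (A : Finset (Submodule K (Fin ℓ → K))) (i : ℕ) : ℤ :=
  (-1) ^ i * (charPoly (⊤ : Submodule K (Fin ℓ → K)) A).coeff (ℓ - i)

/-- Evaluation of the Poincaré polynomial `π(A;t) = Σ μ(X) (-t)^{codim X}` at `t : ℚ`. -/
def poincareEval (A : Finset (Submodule K (Fin ℓ → K))) (t : ℚ) : ℚ :=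
  ∑ X ∈ latticeOf ⊤ A,
    (mob (⊤ : Submodule K (Fin ℓ → K)) (latticeOf ⊤ A) X : ℚ) *
      (-t) ^ (ℓ - Module.finrank K X)

/-- The Euler derivation `θ_E = Σ xᵢ ∂/∂xᵢ`. -/
def eulerD : Deriv K ℓ := fun i => MvPolynomial.X i

/-- `A` is locally free: `A_X` is free for every `X ∈ L(A)` other than `∩_{H∈A} H`. -/
def LocallyFree (A : Finset (Submodule K (Fin ℓ → K))) : Prop :=
  ∀ X ∈ latticeOf ⊤ A, X ≠ A.inf id → IsFree (localize A X)

/-- Transport a finite set of subspaces contained in `T` to `K^m` along a linear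
isomorphism `T ≃ K^m`. -/
def transport {m : ℕ} (T : Submodule K (Fin ℓ → K)) (eqv : T ≃ₗ[K] (Fin m → K))
    (A : Finset (Submodule K (Fin ℓ → K))) : Finset (Submodule K (Fin m → K)) :=
  A.image fun L => (L.comap T.subtype).map eqv.toLinearMap

/-- An arrangement inside the subspace `T` is free with exponents `e`, i.e. it is free
after identifying `T` with a coordinate space. -/
def RestrFreeExp {m : ℕ} (T : Submodule K (Fin ℓ → K))
    (A : Finset (Submodule K (Fin ℓ → K))) (e : Fin m → ℕ) : Prop :=
  ∃ eqv : T ≃ₗ[K] (Fin m → K), IsFreeExp (transport T eqv A) e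

/-- The multiset of exponents. -/
def expMS {n : ℕ} (e : Fin n → ℕ) : Multiset ℕ := Finset.univ.val.map e

/-- `D(A)` has projective dimension at most 1: some finite generating set has a free
(possibly zero) syzygy module, i.e. there is a free resolution
`0 → S^m → S^n → D(A) → 0`. -/
def PdimLEOne (A : Finset (Submodule K (Fin ℓ → K))) : Prop :=
  ∃ (n m : ℕ) (θ : Fin n → Deriv K ℓ) (r : Fin m → Fin n → MvPolynomial (Fin ℓ) K),
    GeneratesD A θ ∧
    (∀ j, (∑ i, r j i • θ i) = 0) ∧
    (∀ c : Fin n → MvPolynomial (Fin ℓ) K, (∑ i, c i • θ i) = 0 →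
      ∃ q : Fin m → MvPolynomial (Fin ℓ) K, ∀ i, c i = ∑ j, q j * r j i) ∧
    (∀ q : Fin m → MvPolynomial (Fin ℓ) K, (∀ i, (∑ j, q j * r j i) = 0) → ∀ j, q j = 0)

/-- `A` has a free filtration `∅ = A₀ ⊂ A₁ ⊂ ⋯ ⊂ A_n = A`, `|A_i| = i`, each `A_i` free. -/
def HasFreeFiltration (A : Finset (Submodule K (Fin ℓ → K))) : Prop :=
  ∃ c : ℕ → Finset (Submodule K (Fin ℓ → K)),
    c A.card = A ∧ (∀ i ≤ A.card, (c i).card = i ∧ IsFree (c i)) ∧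
    ∀ i < A.card, c i ⊆ c (i + 1)

/-- The intersection lattices of `A` and `B` are isomorphic: there is a bijection of
hyperplanes preserving the rank of every subset (equivalently, a lattice isomorphism). -/
def LatticeEquiv (A B : Finset (Submodule K (Fin ℓ → K))) : Prop :=
  ∃ σ : Submodule K (Fin ℓ → K) → Submodule K (Fin ℓ → K),
    Set.BijOn σ ↑A ↑B ∧
    ∀ T ⊆ A, Module.finrank K ((T.inf id : Submodule K (Fin ℓ → K))) =
      Module.finrank K (((T.image σ).inf id : Submodule K (Fin ℓ → K)))



lemma hc_mul {σ : Type} {f B : MvPolynomial σ K} {b : ℕ} (hB : B.IsHomogeneous b) (n : ℕ) :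
    homogeneousComponent n (f * B) = if b ≤ n then homogeneousComponent (n - b) f * B else 0 := by
  have h1 : ∀ i, homogeneousComponent n (homogeneousComponent i f * B)
      = if n = i + b then homogeneousComponent i f * B else 0 := fun i =>
    homogeneousComponent_of_mem (((homogeneousComponent_isHomogeneous i f).mul hB))
  conv_lhs => rw [← sum_homogeneousComponent f, Finset.sum_mul, map_sum]
  simp_rw [h1]
  split_ifs with h
  · by_cases hN : n - b ∈ Finset.range (f.totalDegree + 1)
    · rw [Finset.sum_eq_single_of_mem _ hN]
      · rw [if_pos (by omega)]
      · intro i _ hi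
        rw [if_neg (by omega)]
    · rw [homogeneousComponent_eq_zero (n - b) f (by simp at hN; omega), zero_mul]
      apply Finset.sum_eq_zero
      intro i hi
      rw [if_neg]
      rintro rfl
      simp at hN hi; omega
  · apply Finset.sum_eq_zero
    intro i hi
    rw [if_neg (by omega)]

lemma hom_div {σ : Type} {P f B : MvPolynomial σ K} {n b : ℕ} (hP : P.IsHomogeneous n)
    (hB : B.IsHomogeneous b) (hB0 : B ≠ 0) (h : P = B * f) :
    f.IsHomogeneous (n - b) ∧ (n < b → f = 0) := by
  have h1 := hc_mul (f := f) hB n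
  rw [mul_comm f B, ← h, homogeneousComponent_eq_self hP] at h1
  split_ifs at h1 with hb
  · refine ⟨?_, fun hn => absurd hb (by omega)⟩
    rw [h, mul_comm] at h1
    rw [mul_right_cancel₀ hB0 h1]
    exact homogeneousComponent_isHomogeneous _ _
  · have : f = 0 := by
      rw [h1] at h
      rcases mul_eq_zero.1 h.symm with h | h
      · exact absurd h hB0
      · exact h
    subst this
    exact ⟨isHomogeneous_zero _ _ _, fun _ => rfl⟩

lemma hom_cc {σ : Type} {p : MvPolynomial σ K} {n : ℕ} (hp : p.IsHomogeneous n) (hn : 0 < n) :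
    constantCoeff p = 0 := by
  rw [constantCoeff_eq]
  exact hp.coeff_eq_zero (by simp; omega)

lemma hom_zero_eq_C {σ : Type} {p : MvPolynomial σ K} (hp : p.IsHomogeneous 0) :
    p = C (constantCoeff p) := by
  rw [constantCoeff_eq, ← homogeneousComponent_zero, homogeneousComponent_eq_self hp]

/-- Apply a linear form to a derivation, as a linear map. -/
def ap (φ : Module.Dual K (Fin ℓ → K)) :
    Deriv K ℓ →ₗ[MvPolynomial (Fin ℓ) K] MvPolynomial (Fin ℓ) K where
  toFun θ := applyLin θ φ
  map_add' := by intro a b; simp [applyLin, mul_add, Finset.sum_add_distrib]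
  map_smul' := by
    intro a b; simp only [applyLin, Pi.smul_apply, smul_eq_mul, Finset.mul_sum, RingHom.id_apply]
    exact Finset.sum_congr rfl fun i _ => by ring

lemma applyLin_eq (φ : Module.Dual K (Fin ℓ → K)) (θ : Deriv K ℓ) : applyLin θ φ = ap φ θ := rfl

lemma linPoly_eq (φ : Module.Dual K (Fin ℓ → K)) : linPoly φ = ap φ eulerD := rfl

lemma ap_hom {φ : Module.Dual K (Fin ℓ → K)} {θ : Deriv K ℓ} {n : ℕ} (h : HomogDeriv θ n) :
    (ap φ θ).IsHomogeneous n :=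
  IsHomogeneous.sum _ _ _ fun i _ => (h i).C_mul _

lemma euler_hom : HomogDeriv (eulerD : Deriv K ℓ) 1 := fun _ => isHomogeneous_X _ _

lemma linPoly_hom (φ : Module.Dual K (Fin ℓ → K)) : (linPoly φ).IsHomogeneous 1 :=
  ap_hom euler_hom

lemma dual_apply (φ : Module.Dual K (Fin ℓ → K)) (x : Fin ℓ → K) :
    φ x = ∑ i, φ (Pi.single i 1) * x i := by
  conv_lhs => rw [← Finset.univ_sum_single x]
  rw [map_sum]
  refine Finset.sum_congr rfl fun i _ => ?_
  have : Pi.single i (x i) = (x i) • (Pi.single i (1 : K) : Fin ℓ → K) := by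
    rw [← Pi.single_smul]; simp
  rw [this, map_smul, smul_eq_mul, mul_comm]

lemma eval_linPoly (φ : Module.Dual K (Fin ℓ → K)) (x : Fin ℓ → K) :
    eval x (linPoly φ) = φ x := by
  rw [dual_apply]; simp [linPoly]

lemma linPoly_ne {φ : Module.Dual K (Fin ℓ → K)} (h : φ ≠ 0) : linPoly φ ≠ 0 := by
  intro h0
  apply h
  ext1 i
  ext
  simp [← eval_linPoly, h0]

lemma hom_one_irr {σ : Type} {p : MvPolynomial σ K} (hp : p.IsHomogeneous 1) (h0 : p ≠ 0) :
    Irreducible p := by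
  constructor
  · intro hu
    have := hu.map (constantCoeff (R := K) (σ := σ))
    rw [hom_cc hp one_pos] at this
    simp at this
  · intro a b hab
    have ha : a ≠ 0 := by rintro rfl; simp at hab; exact h0 hab
    have hb : b ≠ 0 := by rintro rfl; simp at hab; exact h0 hab
    have hd := totalDegree_mul_of_isDomain ha hb
    rw [← hab, hp.totalDegree h0] at hd
    have key : ∀ c : MvPolynomial σ K, c ≠ 0 → c.totalDegree = 0 → IsUnit c := by
      intro c hc hcd
      rw [totalDegree_eq_zero_iff_eq_C] at hcd
      rw [isUnit_iff_eq_C_of_isReduced]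
      refine ⟨_, ?_, hcd⟩
      rw [isUnit_iff_ne_zero]
      intro h; rw [h] at hcd; simp at hcd; exact hc hcd
    rcases Nat.eq_zero_or_pos a.totalDegree with h | h
    · exact Or.inl (key a ha h)
    · exact Or.inr (key b hb (by omega))

lemma linPoly_irr {φ : Module.Dual K (Fin ℓ → K)} (h : φ ≠ 0) : Irreducible (linPoly φ) :=
  hom_one_irr (linPoly_hom φ) (linPoly_ne h)

lemma ker_le_eq {φ ψ : Module.Dual K (Fin ℓ → K)} (hφ : φ ≠ 0) (hψ : ψ ≠ 0)
    (h : LinearMap.ker φ ≤ LinearMap.ker ψ) : LinearMap.ker φ = LinearMap.ker ψ := by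
  have hc : IsCoatom (LinearMap.ker φ) :=
    LinearMap.isCoatom_ker_of_surjective (LinearMap.surjective hφ)
  rcases hc.le_iff.1 h with h | h
  · exact absurd (LinearMap.ker_eq_top.1 h) hψ
  · exact h.symm

lemma lin_relprime {φ ψ : Module.Dual K (Fin ℓ → K)} (hφ : φ ≠ 0) (hψ : ψ ≠ 0)
    (h : LinearMap.ker φ ≠ LinearMap.ker ψ) : IsRelPrime (linPoly φ) (linPoly ψ) := by
  rw [(linPoly_irr hφ).isRelPrime_iff_not_dvd]
  rintro ⟨c, hc⟩
  apply h
  apply ker_le_eq hφ hψ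
  intro x hx
  rw [LinearMap.mem_ker] at hx ⊢
  rw [← eval_linPoly, hc, map_mul, eval_linPoly, hx, zero_mul]

lemma same_ker {φ ψ : Module.Dual K (Fin ℓ → K)} (hφ : φ ≠ 0)
    (h : LinearMap.ker φ = LinearMap.ker ψ) : ∃ c : K, c ≠ 0 ∧ ψ = c • φ := by
  have h1 : ψ ∈ Submodule.span K (Set.range (fun _ : Unit => φ)) := by
    apply mem_span_of_iInf_ker_le_ker
    simp [h]
  simp only [Set.range_const, Submodule.mem_span_singleton] at h1
  obtain ⟨c, hc⟩ := h1
  refine ⟨c, ?_, hc.symm⟩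
  rintro rfl
  simp at hc
  rw [← hc] at h
  simp [LinearMap.ker_eq_top] at h
  exact hφ h

lemma ap_smul_dual (c : K) (φ : Module.Dual K (Fin ℓ → K)) (θ : Deriv K ℓ) :
    ap (c • φ) θ = C c * ap φ θ := by
  simp only [← applyLin_eq, applyLin, LinearMap.smul_apply, smul_eq_mul, map_mul, Finset.mul_sum, mul_assoc]

lemma ap_add_dual (φ ψ : Module.Dual K (Fin ℓ → K)) (θ : Deriv K ℓ) :
    ap (φ + ψ) θ = ap φ θ + ap ψ θ := by
  simp only [← applyLin_eq, applyLin, LinearMap.add_apply, map_add, add_mul, Finset.sum_add_distrib]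

/-- A choice of defining forms. -/
def Forms (A : Finset (Submodule K (Fin ℓ → K)))
    (p : Submodule K (Fin ℓ → K) → Module.Dual K (Fin ℓ → K)) : Prop :=
  ∀ L ∈ A, p L ≠ 0 ∧ LinearMap.ker (p L) = L

lemma exists_forms {A : Finset (Submodule K (Fin ℓ → K))} (hA : IsArrangement A) :
    ∃ p, Forms A p := by
  choose! p hp using hA
  exact ⟨p, hp⟩

lemma inD_iff {A : Finset (Submodule K (Fin ℓ → K))} {p} (hp : Forms A p) (θ : Deriv K ℓ) :
    InD A θ ↔ ∀ L ∈ A, linPoly (p L) ∣ ap (p L) θ := by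
  constructor
  · intro h L hL
    exact h L hL _ (hp L hL).2
  · intro h L hL φ hφ
    obtain ⟨c, hc, rfl⟩ := same_ker (hp L hL).1 ((hp L hL).2.trans hφ.symm)
    rw [linPoly_eq, applyLin_eq, ap_smul_dual, ap_smul_dual, ← linPoly_eq]
    exact mul_dvd_mul_left _ (h L hL)

lemma inD_euler (A : Finset (Submodule K (Fin ℓ → K))) : InD A eulerD :=
  fun _ _ φ _ => dvd_refl (linPoly φ)

lemma InD.add {A : Finset (Submodule K (Fin ℓ → K))} {a b : Deriv K ℓ} (ha : InD A a)
    (hb : InD A b) : InD A (a + b) := by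
  intro L hL φ hφ
  rw [applyLin_eq, map_add]
  exact dvd_add (ha L hL φ hφ) (hb L hL φ hφ)

lemma InD.sub {A : Finset (Submodule K (Fin ℓ → K))} {a b : Deriv K ℓ} (ha : InD A a)
    (hb : InD A b) : InD A (a - b) := by
  intro L hL φ hφ
  rw [applyLin_eq, map_sub]
  exact dvd_sub (ha L hL φ hφ) (hb L hL φ hφ)

lemma InD.smul {A : Finset (Submodule K (Fin ℓ → K))} {b : Deriv K ℓ} (a : MvPolynomial (Fin ℓ) K)
    (hb : InD A b) : InD A (a • b) := by
  intro L hL φ hφ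
  rw [applyLin_eq, map_smul]
  exact (hb L hL φ hφ).mul_left _

lemma HomogDeriv.add {a b : Deriv K ℓ} {n} (ha : HomogDeriv a n) (hb : HomogDeriv b n) :
    HomogDeriv (a + b) n := fun i => (ha i).add (hb i)

lemma HomogDeriv.sub {a b : Deriv K ℓ} {n} (ha : HomogDeriv a n) (hb : HomogDeriv b n) :
    HomogDeriv (a - b) n := fun i => (ha i).sub (hb i)

lemma HomogDeriv.smul {b : Deriv K ℓ} {c : MvPolynomial (Fin ℓ) K} {m n k} (hc : c.IsHomogeneous m)
    (hb : HomogDeriv b n) (hk : m + n = k) : HomogDeriv (c • b) k :=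
  fun i => hk ▸ hc.mul (hb i)

/-- The defining polynomial. -/
def QQ (A : Finset (Submodule K (Fin ℓ → K)))
    (p : Submodule K (Fin ℓ → K) → Module.Dual K (Fin ℓ → K)) : MvPolynomial (Fin ℓ) K :=
  ∏ L ∈ A, linPoly (p L)

lemma QQ_ne {A : Finset (Submodule K (Fin ℓ → K))} {p} (hp : Forms A p) : QQ A p ≠ 0 :=
  Finset.prod_ne_zero_iff.2 fun L hL => linPoly_ne (hp L hL).1

lemma QQ_hom (A : Finset (Submodule K (Fin ℓ → K))) (p) : (QQ A p).IsHomogeneous A.card := by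
  have := IsHomogeneous.prod A (fun L => linPoly (p L)) (fun _ => 1) (fun L _ => linPoly_hom _)
  simpa [QQ] using this

lemma forms_relprime {A : Finset (Submodule K (Fin ℓ → K))} {p} (hp : Forms A p) {L M}
    (hL : L ∈ A) (hM : M ∈ A) (h : L ≠ M) : IsRelPrime (linPoly (p L)) (linPoly (p M)) :=
  lin_relprime (hp L hL).1 (hp M hM).1 (by rwa [(hp L hL).2, (hp M hM).2])

lemma QQ_dvd {A : Finset (Submodule K (Fin ℓ → K))} {p} (hp : Forms A p) {z}
    (h : ∀ L ∈ A, linPoly (p L) ∣ z) : QQ A p ∣ z :=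
  Finset.prod_dvd_of_isRelPrime (fun _ hL _ hM hLM => forms_relprime hp hL hM hLM) h


/-- 3x3 determinant. -/
def D3 {R : Type} [CommRing R] (a b c : Fin 3 → R) : R :=
  a 0 * (b 1 * c 2 - b 2 * c 1) - a 1 * (b 0 * c 2 - b 2 * c 0) + a 2 * (b 0 * c 1 - b 1 * c 0)

section D3
variable {R : Type} [CommRing R]

lemma D3_cyc (a b c : Fin 3 → R) : D3 a b c = D3 b c a := by simp only [D3]; ring
lemma D3_swap (a b c : Fin 3 → R) : D3 a b c = - D3 b a c := by simp only [D3]; ring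
lemma D3_swap' (a b c : Fin 3 → R) : D3 a b c = - D3 a c b := by simp only [D3]; ring
lemma D3_self (a c : Fin 3 → R) : D3 a a c = 0 := by simp only [D3]; ring
lemma D3_self' (a c : Fin 3 → R) : D3 a c c = 0 := by simp only [D3]; ring
lemma D3_self'' (a c : Fin 3 → R) : D3 a c a = 0 := by simp only [D3]; ring

/-- linear in the first variable -/
def D3l (b c : Fin 3 → R) : (Fin 3 → R) →ₗ[R] R where
  toFun a := D3 a b c
  map_add' := by intro x y; simp only [D3, Pi.add_apply]; ring
  map_smul' := by intro x y; simp only [D3, Pi.smul_apply, smul_eq_mul, RingHom.id_apply]; ring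

lemma D3_dvd_sum {n : ℕ} (g : Fin n → Fin 3 → R) (d : R) (b c : Fin 3 → R)
    (h : ∀ i, d ∣ D3 (g i) b c) (q : Fin n → R) : d ∣ D3 (∑ i, q i • g i) b c := by
  change d ∣ D3l b c _
  rw [map_sum]
  refine Finset.dvd_sum fun i _ => ?_
  rw [map_smul]
  exact (h i).mul_left _

lemma D3_dvd_span {n : ℕ} (g : Fin n → Fin 3 → R) (d : R)
    (h : ∀ i j k, i < j → j < k → d ∣ D3 (g i) (g j) (g k)) (a b c : Fin 3 → R)
    (ha : ∃ q : Fin n → R, a = ∑ i, q i • g i) (hb : ∃ q : Fin n → R, b = ∑ i, q i • g i)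
    (hc : ∃ q : Fin n → R, c = ∑ i, q i • g i) : d ∣ D3 a b c := by
  have key : ∀ i j k, d ∣ D3 (g i) (g j) (g k) := by
    have k1 : ∀ i j k, i < j → d ∣ D3 (g i) (g j) (g k) := by
      intro i j k hij
      rcases lt_trichotomy j k with hk | hk | hk
      · exact h i j k hij hk
      · rw [hk, D3_self']; exact dvd_zero _
      · rcases lt_trichotomy i k with hk' | hk' | hk'
        · rw [D3_swap']; exact (h _ _ _ hk' hk).neg_right
        · rw [hk', D3_self'']; exact dvd_zero _
        · rw [← D3_cyc]; exact h _ _ _ hk' hij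
    intro i j k
    rcases lt_trichotomy i j with hk | hk | hk
    · exact k1 i j k hk
    · rw [hk, D3_self]; exact dvd_zero _
    · rw [D3_swap]; exact (k1 _ _ _ hk).neg_right
  obtain ⟨qa, rfl⟩ := ha
  obtain ⟨qb, rfl⟩ := hb
  obtain ⟨qc, rfl⟩ := hc
  refine D3_dvd_sum _ _ _ _ (fun i => ?_) _
  rw [D3_cyc]
  refine D3_dvd_sum _ _ _ _ (fun j => ?_) _
  rw [D3_cyc]
  refine D3_dvd_sum _ _ _ _ (fun k => ?_) _
  rw [D3_cyc]
  exact key i j k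

lemma D3_mul (a b c P Q S : Fin 3 → R) :
    D3 P Q S * D3 a b c = D3 ![∑ i, P i * a i, ∑ i, Q i * a i, ∑ i, S i * a i]
      ![∑ i, P i * b i, ∑ i, Q i * b i, ∑ i, S i * b i]
      ![∑ i, P i * c i, ∑ i, Q i * c i, ∑ i, S i * c i] := by
  simp [D3, Fin.sum_univ_three]
  ring

lemma D3_cramer (a b c x : Fin 3 → R) :
    D3 a b c • x = D3 x b c • a + D3 a x c • b + D3 a b x • c := by
  ext i
  fin_cases i <;> simp [D3] <;> ring

lemma D3_indep [IsDomain R] {a b c : Fin 3 → R} (h : D3 a b c ≠ 0) {x y z : R}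
    (h0 : x • a + y • b + z • c = 0) : x = 0 ∧ y = 0 ∧ z = 0 := by
  have e := fun i => congrFun h0 i
  have e0 := e 0
  have e1 := e 1
  have e2 := e 2
  simp only [Pi.add_apply, Pi.smul_apply, smul_eq_mul, Pi.zero_apply] at e0 e1 e2
  refine ⟨?_, ?_, ?_⟩ <;> refine (mul_eq_zero.1 (?_ : D3 a b c * _ = 0)).resolve_left h <;>
    simp only [D3]
  · linear_combination (b 1 * c 2 - b 2 * c 1) * e0 - (b 0 * c 2 - b 2 * c 0) * e1 +
      (b 0 * c 1 - b 1 * c 0) * e2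
  · linear_combination (c 1 * a 2 - c 2 * a 1) * e0 - (c 0 * a 2 - c 2 * a 0) * e1 +
      (c 0 * a 1 - c 1 * a 0) * e2
  · linear_combination (a 1 * b 2 - a 2 * b 1) * e0 - (a 0 * b 2 - a 2 * b 0) * e1 +
      (a 0 * b 1 - a 1 * b 0) * e2

end D3

lemma D3_hom {a b c : Deriv K 3} {l m n : ℕ} (ha : HomogDeriv a l) (hb : HomogDeriv b m)
    (hc : HomogDeriv c n) : (D3 a b c).IsHomogeneous (l + m + n) := by
  have h : ∀ i j k, (a i * (b j * c k)).IsHomogeneous (l + m + n) := fun i j k => by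
    rw [add_assoc]; exact (ha i).mul ((hb j).mul (hc k))
  unfold D3
  simp only [mul_sub]
  exact (((h _ _ _).sub (h _ _ _)).sub ((h _ _ _).sub (h _ _ _))).add ((h _ _ _).sub (h _ _ _))

/-- constant derivation -/
def cst (v : Fin ℓ → K) : Deriv K ℓ := fun i => C (v i)

lemma ap_cst (φ : Module.Dual K (Fin ℓ → K)) (v : Fin ℓ → K) : ap φ (cst v) = C (φ v) := by
  rw [dual_apply, map_sum]
  simp only [← applyLin_eq, applyLin, cst, map_mul]

lemma D3_cst (a b c : Fin 3 → K) : D3 (cst a) (cst b) (cst c) = C (D3 a b c) := by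
  simp [D3, cst]

/-- coordinates adapted to a hyperplane -/
structure HP (φ : Module.Dual K (Fin 3 → K)) where
  r1 : Module.Dual K (Fin 3 → K)
  r2 : Module.Dual K (Fin 3 → K)
  w : Fin 3 → K
  v1 : Fin 3 → K
  v2 : Fin 3 → K
  pw : φ w = 1
  p1 : φ v1 = 0
  p2 : φ v2 = 0
  r1w : r1 w = 0
  r11 : r1 v1 = 1
  r12 : r1 v2 = 0
  r2w : r2 w = 0
  r21 : r2 v1 = 0
  r22 : r2 v2 = 1
  dec : ∀ x, x = φ x • w + r1 x • v1 + r2 x • v2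

lemma exists_HP {φ : Module.Dual K (Fin 3 → K)} (h : φ ≠ 0) : Nonempty (HP φ) := by
  have key : ∀ i j k : Fin 3, i ≠ j → i ≠ k → j ≠ k → φ (Pi.single k 1) ≠ 0 →
      Nonempty (HP φ) := by
    intro i j k hij hik hjk hk
    have hcov : ∀ m : Fin 3, m = i ∨ m = j ∨ m = k := by omega
    have hs : ∀ x : Fin 3 → K, φ x = φ (Pi.single i 1) * x i + φ (Pi.single j 1) * x j
        + φ (Pi.single k 1) * x k := by
      intro x
      rw [dual_apply φ x, ← Finset.sum_subset (Finset.subset_univ {i, j, k})]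
      · rw [Finset.sum_insert (by simp [hij, hik]), Finset.sum_insert (by simp [hjk]),
          Finset.sum_singleton, add_assoc]
      · intro m _ hm
        rcases hcov m with rfl | rfl | rfl <;> simp at hm
    refine ⟨{ r1 := LinearMap.proj i, r2 := LinearMap.proj j,
              w := (φ (Pi.single k 1))⁻¹ • Pi.single k 1,
              v1 := Pi.single i 1 - (φ (Pi.single i 1) * (φ (Pi.single k 1))⁻¹) • Pi.single k 1,
              v2 := Pi.single j 1 - (φ (Pi.single j 1) * (φ (Pi.single k 1))⁻¹) • Pi.single k 1,
              pw := ?_, p1 := ?_, p2 := ?_, r1w := ?_, r11 := ?_, r12 := ?_, r2w := ?_,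
              r21 := ?_, r22 := ?_, dec := ?_ }⟩
    · simp [hk]
    · simp [hk]
    · simp [hk]
    · simp [hik]
    · simp [hik]
    · simp [hik, hij]
    · simp [hjk]
    · simp [hjk, hij.symm]
    · simp [hjk]
    · intro x
      ext m
      rcases hcov m with rfl | rfl | rfl
      · simp [hij, hik]
      · simp [hij.symm, hjk]
      · rw [hs x]
        simp [hik.symm, hjk.symm]
        field_simp
        ring
  by_contra hcon
  apply h
  ext1 m
  ext
  simp only [LinearMap.comp_apply, LinearMap.single_apply, LinearMap.zero_apply]
  by_contra hm
  apply hcon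
  fin_cases m
  · exact key 1 2 0 (by decide) (by decide) (by decide) hm
  · exact key 0 2 1 (by decide) (by decide) (by decide) hm
  · exact key 0 1 2 (by decide) (by decide) (by decide) hm

namespace HP
variable {φ : Module.Dual K (Fin 3 → K)} (P : HP φ)

lemma det_ne : D3 P.w P.v1 P.v2 ≠ 0 ∧
    D3 (fun i => φ (Pi.single i 1)) (fun i => P.r1 (Pi.single i 1))
      (fun i => P.r2 (Pi.single i 1)) ≠ 0 := by
  have h := D3_mul P.w P.v1 P.v2 (fun i => φ (Pi.single i 1)) (fun i => P.r1 (Pi.single i 1))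
      (fun i => P.r2 (Pi.single i 1))
  simp only [← dual_apply, P.pw, P.p1, P.p2, P.r1w, P.r11, P.r12, P.r2w, P.r21, P.r22] at h
  have h1 : D3 ![(1 : K), 0, 0] ![0, 1, 0] ![0, 0, 1] = 1 := by simp [D3]
  rw [h1] at h
  constructor <;> intro h0 <;> simp [h0] at h

lemma det_coord : ∃ κ : K, κ ≠ 0 ∧ ∀ a b c : Deriv K 3, C κ * D3 a b c =
    D3 ![ap φ a, ap P.r1 a, ap P.r2 a] ![ap φ b, ap P.r1 b, ap P.r2 b]
      ![ap φ c, ap P.r1 c, ap P.r2 c] := by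
  refine ⟨_, P.det_ne.2, fun a b c => ?_⟩
  rw [← D3_cst, D3_mul]
  rfl

lemma dec' (θ : Deriv K 3) : θ = ap φ θ • cst P.w + ap P.r1 θ • cst P.v1 + ap P.r2 θ • cst P.v2 := by
  ext1 i
  have h : ∀ j : Fin 3, C (if i = j then (1 : K) else 0) = (C (φ (Pi.single j 1)) * C (P.w i)
      + C (P.r1 (Pi.single j 1)) * C (P.v1 i) + C (P.r2 (Pi.single j 1)) * C (P.v2 i) :
      MvPolynomial (Fin 3) K) := by
    intro j
    have := congrFun (P.dec (Pi.single j 1)) i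
    simp only [Pi.add_apply, Pi.smul_apply, smul_eq_mul, Pi.single_apply] at this
    rw [this]; simp
  simp only [Pi.add_apply, Pi.smul_apply, smul_eq_mul, ← applyLin_eq, applyLin, cst,
    Finset.sum_mul, ← Finset.sum_add_distrib]
  have h2 : ∀ j : Fin 3, C (φ (Pi.single j 1)) * θ j * C (P.w i)
      + C (P.r1 (Pi.single j 1)) * θ j * C (P.v1 i) + C (P.r2 (Pi.single j 1)) * θ j * C (P.v2 i)
      = C (if i = j then (1 : K) else 0) * θ j := by
    intro j; rw [h j]; ring
  simp_rw [h2]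
  simp [apply_ite C, ite_mul]

end HP

lemma D3_dvd {A : Finset (Submodule K (Fin 3 → K))} {p} (hp : Forms A p) {a b c : Deriv K 3}
    (ha : InD A a) (hb : InD A b) (hc : InD A c) : QQ A p ∣ D3 a b c := by
  rw [inD_iff hp] at ha hb hc
  refine QQ_dvd hp fun L hL => ?_
  obtain ⟨P⟩ := exists_HP (hp L hL).1
  obtain ⟨κ, hκ, h⟩ := P.det_coord
  have h1 := h a b c
  have hu : IsUnit (C κ : MvPolynomial (Fin 3) K) := (isUnit_iff_ne_zero.2 hκ).map C
  rw [← hu.dvd_mul_left, h1]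
  simp only [D3, Matrix.cons_val]
  have ha' := ha L hL
  have hb' := hb L hL
  have hc' := hc L hL
  refine dvd_add (dvd_sub (ha'.mul_right _) ?_) ?_
  · exact (dvd_sub (hb'.mul_right _) (hc'.mul_left _)).mul_left _
  · exact (dvd_sub (hb'.mul_right _) (hc'.mul_left _)).mul_left _

lemma D3_smul (x y z : MvPolynomial (Fin 3) K) (a b c : Deriv K 3) :
    D3 (x • a) (y • b) (z • c) = x * y * z * D3 a b c := by
  simp [D3]; ring

lemma unit_of_dvd {A : Finset (Submodule K (Fin 3 → K))} {p} (hp : Forms A p)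
    {h : MvPolynomial (Fin 3) K}
    (hh : ∀ a b c, InD A a → InD A b → InD A c → h * QQ A p ∣ D3 a b c) : IsUnit h := by
  have h1 : ∀ L ∈ A, IsRelPrime h (linPoly (p L)) := by
    intro L hL
    obtain ⟨P⟩ := exists_HP (hp L hL).1
    have hQ : linPoly (p L) * QQ (A.erase L) p = QQ A p := Finset.mul_prod_erase A _ hL
    have i0 : InD A (QQ A p • cst P.w) := by
      rw [inD_iff hp]; intro M hM
      rw [map_smul]
      exact (Finset.dvd_prod_of_mem _ hM).mul_right _
    have i1 : ∀ v, p L v = 0 → InD A (QQ (A.erase L) p • cst v) := by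
      intro v hv
      rw [inD_iff hp]; intro M hM
      rw [map_smul]
      by_cases hML : M = L
      · rw [hML, ap_cst, hv]; simp
      · exact (Finset.dvd_prod_of_mem (fun M => linPoly (p M))
          (Finset.mem_erase.2 ⟨hML, hM⟩)).mul_right _
    have h2 := hh _ _ _ i0 (i1 _ P.p1) (i1 _ P.p2)
    rw [D3_smul, D3_cst] at h2
    have hu : IsUnit (C (D3 P.w P.v1 P.v2) : MvPolynomial (Fin 3) K) :=
      (isUnit_iff_ne_zero.2 P.det_ne.1).map C
    rw [hu.dvd_mul_right, mul_assoc, mul_comm h] at h2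
    have h3 := (mul_dvd_mul_iff_left (QQ_ne hp)).1 h2
    have h4 : IsRelPrime (QQ (A.erase L) p) (linPoly (p L)) :=
      IsRelPrime.prod_left fun M hM =>
        forms_relprime hp (Finset.mem_of_mem_erase hM) hL (Finset.ne_of_mem_erase hM)
    exact fun d hd hd' => (h4.mul_left h4) (hd.trans h3) hd'
  have h2 : IsRelPrime h (QQ A p) := IsRelPrime.prod_right h1
  have i0 : ∀ v, InD A (QQ A p • cst v) := by
    intro v
    rw [inD_iff hp]; intro M hM
    rw [map_smul]
    exact (Finset.dvd_prod_of_mem _ hM).mul_right _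
  have h3 := hh _ _ _ (i0 ![1,0,0]) (i0 ![0,1,0]) (i0 ![0,0,1])
  rw [D3_smul, D3_cst] at h3
  have h4 : D3 ![(1 : K), 0, 0] ![0, 1, 0] ![0, 0, 1] = 1 := by simp [D3]
  rw [h4, map_one, mul_one, mul_assoc, mul_comm h] at h3
  have h5 := (mul_dvd_mul_iff_left (QQ_ne hp)).1 h3
  exact (h2.mul_right h2) dvd_rfl h5

/-- Saito: a basis has determinant `c * Q`. -/
lemma saito {A : Finset (Submodule K (Fin 3 → K))} {p} (hp : Forms A p) {a b c : Deriv K 3}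
    (ha : InD A a) (hb : InD A b) (hc : InD A c)
    (hgen : ∀ η, InD A η → ∃ x y z : MvPolynomial (Fin 3) K, η = x • a + y • b + z • c) :
    ∃ k : K, k ≠ 0 ∧ D3 a b c = C k * QQ A p := by
  obtain ⟨h, hh⟩ := D3_dvd hp ha hb hc
  have hu : IsUnit h := by
    apply unit_of_dvd hp
    intro x y z hx hy hz
    have key : ∀ η, InD A η → ∃ q : Fin 3 → MvPolynomial (Fin 3) K, η = ∑ i, q i • ![a, b, c] i := by
      intro η hη
      obtain ⟨x, y, z, h⟩ := hgen η hη
      exact ⟨![x, y, z], by simp [Fin.sum_univ_three, h]⟩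
    refine D3_dvd_span ![a, b, c] _ ?_ x y z (key x hx) (key y hy) (key z hz)
    intro i j k hij hjk
    obtain ⟨rfl, rfl, rfl⟩ : i = 0 ∧ j = 1 ∧ k = 2 := by revert i j k; decide
    simp [hh, mul_comm]
  rw [isUnit_iff_eq_C_of_isReduced] at hu
  obtain ⟨r, hr, rfl⟩ := hu
  exact ⟨r, hr.ne_zero, by rw [hh, mul_comm]⟩

/-- Saito converse. -/
lemma saito_conv {A : Finset (Submodule K (Fin 3 → K))} {p} (hp : Forms A p) {a b c : Deriv K 3}
    (ha : InD A a) (hb : InD A b) (hc : InD A c) {k : K} (hk : k ≠ 0)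
    (h : D3 a b c = C k * QQ A p) (η : Deriv K 3) (hη : InD A η) :
    ∃ x y z : MvPolynomial (Fin 3) K, η = x • a + y • b + z • c := by
  obtain ⟨x, hx⟩ := D3_dvd hp hη hb hc
  obtain ⟨y, hy⟩ := D3_dvd hp ha hη hc
  obtain ⟨z, hz⟩ := D3_dvd hp ha hb hη
  have h1 := D3_cramer a b c η
  rw [h, hx, hy, hz] at h1
  refine ⟨C k⁻¹ * x, C k⁻¹ * y, C k⁻¹ * z, ?_⟩
  have hkk : (C k⁻¹ * C k : MvPolynomial (Fin 3) K) = 1 := by rw [← C_mul, inv_mul_cancel₀ hk, C_1]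
  ext1 i
  have h2 := congrFun h1 i
  simp only [Pi.add_apply, Pi.smul_apply, smul_eq_mul] at h2 ⊢
  apply mul_left_cancel₀ (QQ_ne hp)
  linear_combination C k⁻¹ * h2 - QQ A p * η i * hkk


namespace HP
variable {φ : Module.Dual K (Fin 3 → K)} (P : HP φ)

/-- restriction to the hyperplane -/
def rho : MvPolynomial (Fin 3) K →ₐ[K] MvPolynomial (Fin 2) K :=
  aeval fun i => C (P.v1 i) * X 0 + C (P.v2 i) * X 1

/-- section of the restriction -/
def sig : MvPolynomial (Fin 2) K →ₐ[K] MvPolynomial (Fin 3) K :=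
  aeval ![linPoly P.r1, linPoly P.r2]

/-- inclusion of the hyperplane -/
def inc : (Fin 2 → K) →ₗ[K] (Fin 3 → K) :=
  (LinearMap.proj 0).smulRight P.v1 + (LinearMap.proj 1).smulRight P.v2

lemma rho_C (c : K) : P.rho (C c) = C c := by simp [rho]

lemma sig_C (c : K) : P.sig (C c) = C c := by simp [sig]

lemma rho_hom {f} {n : ℕ} (hf : f.IsHomogeneous n) : (P.rho f).IsHomogeneous n := by
  have := hf.aeval (fun i => C (P.v1 i) * X 0 + C (P.v2 i) * X 1 : Fin 3 → MvPolynomial (Fin 2) K)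
    (n := 1) (fun i => ((isHomogeneous_X _ _).C_mul _).add ((isHomogeneous_X _ _).C_mul _))
  rw [one_mul] at this; exact this

lemma sig_hom {f} {n : ℕ} (hf : f.IsHomogeneous n) : (P.sig f).IsHomogeneous n := by
  have := hf.aeval (![linPoly P.r1, linPoly P.r2] : Fin 2 → MvPolynomial (Fin 3) K)
    (n := 1) (fun i => by fin_cases i <;> exact linPoly_hom _)
  rw [one_mul] at this; exact this

lemma rho_lin (ψ : Module.Dual K (Fin 3 → K)) :
    P.rho (linPoly ψ) = C (ψ P.v1) * X 0 + C (ψ P.v2) * X 1 := by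
  rw [dual_apply ψ P.v1, dual_apply ψ P.v2]
  simp [rho, linPoly, Fin.sum_univ_three]
  ring

lemma rho_lin' (ψ : Module.Dual K (Fin 3 → K)) :
    P.rho (linPoly ψ) = linPoly (ψ ∘ₗ P.inc) := by
  rw [rho_lin]
  simp [linPoly, inc, Fin.sum_univ_two]

lemma rho_self : P.rho (linPoly φ) = 0 := by
  rw [rho_lin, P.p1, P.p2]; simp

lemma rho_r1 : P.rho (linPoly P.r1) = X 0 := by
  rw [rho_lin, P.r11, P.r12]; simp

lemma rho_r2 : P.rho (linPoly P.r2) = X 1 := by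
  rw [rho_lin, P.r21, P.r22]; simp

lemma rho_sig (t) : P.rho (P.sig t) = t := by
  have : (P.rho.comp P.sig) = AlgHom.id K _ := by
    apply MvPolynomial.algHom_ext
    intro i
    fin_cases i
    · simp [sig, rho_r1]
    · simp [sig, rho_r2]
  exact congrArg (fun f => f t) this

lemma sig_rho (p) : linPoly φ ∣ p - P.sig (P.rho p) := by
  induction p using MvPolynomial.induction_on with
  | C a => simp [rho_C, sig_C]
  | add p q hp hq =>
    have := dvd_add hp hq
    convert this using 1
    simp; ring
  | mul_X p i hp =>
    have hX : (X i : MvPolynomial (Fin 3) K) - P.sig (P.rho (X i)) = linPoly φ * C (P.w i) := by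
      have h := congrFun (P.dec' eulerD) i
      simp only [Pi.add_apply, Pi.smul_apply, smul_eq_mul, cst, ← linPoly_eq, eulerD] at h
      have h2 : P.sig (P.rho (X i)) = linPoly P.r1 * C (P.v1 i) + linPoly P.r2 * C (P.v2 i) := by
        simp [rho, sig, mul_comm]
      rw [h2]
      linear_combination h
    have : p * X i - P.sig (P.rho (p * X i)) =
      (p - P.sig (P.rho p)) * X i + P.sig (P.rho p) * (X i - P.sig (P.rho (X i))) := by
      simp only [map_mul]; ring
    rw [this, hX]
    exact dvd_add (hp.mul_right _) ((dvd_mul_right _ _).mul_left _)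

lemma rho_eq_zero {p} : P.rho p = 0 ↔ linPoly φ ∣ p := by
  constructor
  · intro h
    have := P.sig_rho p
    simpa [h] using this
  · rintro ⟨q, rfl⟩
    rw [map_mul, rho_self, zero_mul]

lemma phi_ne (P : HP φ) : φ ≠ 0 := by
  intro h
  have h1 := P.pw
  have h2 := LinearMap.congr_fun h P.w
  rw [h1] at h2
  simp at h2

lemma inc_mem (x) : P.inc x ∈ LinearMap.ker φ := by
  simp [inc, P.p1, P.p2]

lemma mem_ker {x} (hx : x ∈ LinearMap.ker φ) : ∃ y, P.inc y = x := by
  refine ⟨![P.r1 x, P.r2 x], ?_⟩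
  have := P.dec x
  rw [LinearMap.mem_ker.1 hx] at this
  rw [this]
  simp [inc, P.r1w, P.r11, P.r12, P.r2w, P.r21, P.r22]

lemma comp_ne {ψ : Module.Dual K (Fin 3 → K)} (hψ : ψ ≠ 0)
    (h : LinearMap.ker ψ ≠ LinearMap.ker φ) : ψ ∘ₗ P.inc ≠ 0 := by
  intro h0
  apply h
  symm
  apply ker_le_eq P.phi_ne hψ
  intro x hx
  obtain ⟨y, rfl⟩ := P.mem_ker hx
  exact congrArg (fun f => f y) h0

lemma rho_lin_ne {ψ : Module.Dual K (Fin 3 → K)} (hψ : ψ ≠ 0)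
    (h : LinearMap.ker ψ ≠ LinearMap.ker φ) : P.rho (linPoly ψ) ≠ 0 := by
  rw [rho_lin']
  exact linPoly_ne (P.comp_ne hψ h)

lemma rho_relprime {ψ χ : Module.Dual K (Fin 3 → K)} (hψ : ψ ≠ 0)
    (h : LinearMap.ker ψ ≠ LinearMap.ker φ) (hχ : χ ≠ 0)
    (h' : LinearMap.ker χ ≠ LinearMap.ker φ)
    (hne : LinearMap.ker ψ ⊓ LinearMap.ker φ ≠ LinearMap.ker χ ⊓ LinearMap.ker φ) :
    IsRelPrime (P.rho (linPoly ψ)) (P.rho (linPoly χ)) := by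
  rw [rho_lin', rho_lin']
  refine lin_relprime (P.comp_ne hψ h) (P.comp_ne hχ h') fun heq => hne ?_
  have key : ∀ y, ψ (P.inc y) = 0 ↔ χ (P.inc y) = 0 := fun y => by
    have : y ∈ LinearMap.ker (ψ ∘ₗ P.inc) ↔ y ∈ LinearMap.ker (χ ∘ₗ P.inc) := by rw [heq]
    simpa using this
  ext x
  simp only [Submodule.mem_inf]
  constructor <;> rintro ⟨h1, h2⟩ <;> refine ⟨?_, h2⟩ <;> obtain ⟨y, rfl⟩ := P.mem_ker h2
  · exact (key y).1 h1
  · exact (key y).2 h1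

/-- the restricted determinant with the Euler derivation -/
def lam (θ : Deriv K 3) : MvPolynomial (Fin 2) K :=
  X 0 * P.rho (ap P.r2 θ) - X 1 * P.rho (ap P.r1 θ)

lemma lam_add (a b) : P.lam (a + b) = P.lam a + P.lam b := by simp [lam]; ring
lemma lam_sub (a b) : P.lam (a - b) = P.lam a - P.lam b := by simp [lam]; ring
lemma lam_smul (a b) : P.lam (a • b) = P.rho a * P.lam b := by simp [lam]; ring

lemma lam_hom {θ : Deriv K 3} {n : ℕ} (h : HomogDeriv θ n) : (P.lam θ).IsHomogeneous (1 + n) :=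
  ((isHomogeneous_X _ _).mul (P.rho_hom (ap_hom h))).sub
    ((isHomogeneous_X _ _).mul (P.rho_hom (ap_hom h)))

lemma rho_ap {θ : Deriv K 3} (h : P.rho (ap φ θ) = 0) (ψ : Module.Dual K (Fin 3 → K)) :
    P.rho (ap ψ θ) = C (ψ P.v1) * P.rho (ap P.r1 θ) + C (ψ P.v2) * P.rho (ap P.r2 θ) := by
  have hψ : ψ = ψ P.w • φ + ψ P.v1 • P.r1 + ψ P.v2 • P.r2 := by
    refine LinearMap.ext fun x => ?_
    conv_lhs => rw [P.dec x]
    simp [mul_comm]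
  conv_lhs => rw [hψ]
  simp only [ap_add_dual, ap_smul_dual, map_add, map_mul, rho_C, h]
  ring

lemma lam_dvd {θ : Deriv K 3} (h : linPoly φ ∣ ap φ θ) {ψ : Module.Dual K (Fin 3 → K)}
    (h' : linPoly ψ ∣ ap ψ θ) (hψ : ψ ≠ 0)
    (hk : LinearMap.ker ψ ≠ LinearMap.ker φ) : P.rho (linPoly ψ) ∣ P.lam θ := by
  have h1 := P.rho_ap ((P.rho_eq_zero).2 h) ψ
  have h2 : P.rho (linPoly ψ) ∣ P.rho (ap ψ θ) := map_dvd P.rho h'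
  rw [h1] at h2
  obtain ⟨q, hq⟩ := h2
  have h3 := P.rho_lin ψ
  rw [h3] at hq ⊢
  have hu : ∀ c : K, c ≠ 0 → IsUnit (C c : MvPolynomial (Fin 2) K) :=
    fun c hc => (isUnit_iff_ne_zero.2 hc).map C
  by_cases c1 : ψ P.v1 = 0
  · have c2 : ψ P.v2 ≠ 0 := by
      intro c2
      apply P.rho_lin_ne hψ hk
      rw [h3, c1, c2]; simp
    rw [← (hu _ c2).dvd_mul_left]
    refine ⟨X 0 * q - P.rho (ap P.r1 θ), ?_⟩
    unfold lam
    linear_combination X 0 * hq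
  · rw [← (hu _ c1).dvd_mul_left]
    refine ⟨P.rho (ap P.r2 θ) - X 1 * q, ?_⟩
    unfold lam
    linear_combination - X 1 * hq

lemma det_rho : ∃ κ : K, κ ≠ 0 ∧ ∀ a b : Deriv K 3, C κ * P.rho (D3 eulerD a b) =
    P.rho (ap φ b) * P.lam a - P.rho (ap φ a) * P.lam b := by
  obtain ⟨κ, hκ, h⟩ := P.det_coord
  refine ⟨κ, hκ, fun a b => ?_⟩
  have := congrArg P.rho (h eulerD a b)
  rw [map_mul, rho_C] at this
  rw [this]
  simp only [D3, Matrix.cons_val, ← linPoly_eq, map_add, map_sub, map_mul, rho_self, rho_r1, rho_r2,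
    lam]
  ring

lemma lam_euler : P.lam eulerD = 0 := by
  simp only [lam, ← linPoly_eq, rho_r1, rho_r2]; ring

lemma dvd_all {θ : Deriv K 3} (h0 : linPoly φ ∣ ap φ θ) (h1 : linPoly φ ∣ ap P.r1 θ)
    (h2 : linPoly φ ∣ ap P.r2 θ) : ∃ η, θ = linPoly φ • η := by
  obtain ⟨x, hx⟩ := h0
  obtain ⟨y, hy⟩ := h1
  obtain ⟨z, hz⟩ := h2
  refine ⟨x • cst P.w + y • cst P.v1 + z • cst P.v2, ?_⟩
  rw [P.dec' θ, hx, hy, hz]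
  simp only [smul_add, smul_smul]

lemma lam_zero {θ : Deriv K 3} {n : ℕ} (hn : HomogDeriv θ (n + 1)) (h : linPoly φ ∣ ap φ θ)
    (hl : P.lam θ = 0) : ∃ (g : MvPolynomial (Fin 3) K) (η : Deriv K 3), θ = g • eulerD + linPoly φ • η ∧ HomogDeriv η n := by
  have h01 : IsRelPrime (X 0 : MvPolynomial (Fin 2) K) (X 1) := by
    rw [(hom_one_irr (isHomogeneous_X _ _) (X_ne_zero _)).isRelPrime_iff_not_dvd]
    simp [X_dvd_X]
  have hd : (X 0 : MvPolynomial (Fin 2) K) ∣ X 1 * P.rho (ap P.r1 θ) :=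
    ⟨P.rho (ap P.r2 θ), by unfold lam at hl; linear_combination -hl⟩
  obtain ⟨g, hg⟩ := h01.dvd_of_dvd_mul_left hd
  have hg2 : P.rho (ap P.r2 θ) = X 1 * g := by
    apply mul_left_cancel₀ (X_ne_zero (R := K) (0 : Fin 2))
    unfold lam at hl
    rw [hg] at hl
    linear_combination hl
  have hgh : g.IsHomogeneous n := by
    have := (hom_div (P.rho_hom (ap_hom hn)) (isHomogeneous_X _ _) (X_ne_zero _) hg).1
    simpa using this
  obtain ⟨η, hη⟩ := P.dvd_all (θ := θ - P.sig g • eulerD)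
    (by rw [map_sub, map_smul]; exact dvd_sub h ((dvd_refl (linPoly φ)).mul_left _))
    (by rw [← rho_eq_zero, map_sub, map_smul, ← linPoly_eq, map_sub, smul_eq_mul, map_mul,
          rho_sig, rho_r1, hg]; ring)
    (by rw [← rho_eq_zero, map_sub, map_smul, ← linPoly_eq, map_sub, smul_eq_mul, map_mul,
          rho_sig, rho_r2, hg2]; ring)
  refine ⟨P.sig g, η, by rw [← hη]; simp, fun i => ?_⟩
  have hh : HomogDeriv (θ - P.sig g • eulerD) (n + 1) :=
    hn.sub (euler_hom.smul (P.sig_hom hgh) rfl)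
  have := (hom_div (hh i) (linPoly_hom φ) (linPoly_ne P.phi_ne) (congrFun hη i)).1
  simpa using this

end HP


lemma HP.same_rest {φ : Module.Dual K (Fin 3 → K)} (P : HP φ) {ψ χ : Module.Dual K (Fin 3 → K)}
    (hχ : χ ≠ 0) (h' : LinearMap.ker χ ≠ LinearMap.ker φ)
    (he : LinearMap.ker ψ ⊓ LinearMap.ker φ = LinearMap.ker χ ⊓ LinearMap.ker φ) :
    ∃ c b : K, c ≠ 0 ∧ ψ = c • χ + b • φ := by
  have hk : LinearMap.ker (χ ∘ₗ P.inc) = LinearMap.ker (ψ ∘ₗ P.inc) := by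
    ext y
    have h1 : P.inc y ∈ LinearMap.ker ψ ⊓ LinearMap.ker φ ↔
      P.inc y ∈ LinearMap.ker χ ⊓ LinearMap.ker φ := by rw [he]
    simp only [Submodule.mem_inf, P.inc_mem, and_true] at h1
    exact h1.symm
  obtain ⟨c, hc, h⟩ := same_ker (P.comp_ne hχ h') hk
  have hi1 : P.inc (Pi.single 0 1) = P.v1 := by simp [HP.inc]
  have hi2 : P.inc (Pi.single 1 1) = P.v2 := by simp [HP.inc]
  have e1 := LinearMap.congr_fun h (Pi.single 0 1)
  have e2 := LinearMap.congr_fun h (Pi.single 1 1)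
  simp only [LinearMap.comp_apply, LinearMap.smul_apply, hi1, hi2] at e1 e2
  refine ⟨c, ψ P.w - c * χ P.w, hc, LinearMap.ext fun x => ?_⟩
  rw [P.dec x]
  simp only [map_add, map_smul, LinearMap.add_apply, LinearMap.smul_apply, smul_eq_mul, e1, e2,
    P.p1, P.p2, P.pw]
  ring

lemma exists_rep {A : Finset (Submodule K (Fin 3 → K))} {p} (hp : Forms A p)
    {H : Submodule K (Fin 3 → K)} (hH : H ∈ A) (P : HP (p H)) :
    ∃ (Q B : MvPolynomial (Fin 2) K) (b : ℕ), Q ≠ 0 ∧ B ≠ 0 ∧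
      Q.IsHomogeneous (restrict A H).card ∧ B.IsHomogeneous b ∧
      b + (restrict A H).card = (A.erase H).card ∧
      P.rho (QQ (A.erase H) p) = B * Q ∧
      (∀ θ, InD A θ → Q ∣ P.lam θ) ∧
      (∀ θ, InD (A.erase H) θ → B ∣ P.rho (ap (p H) θ)) := by
  have hex : ∀ X ∈ restrict A H, ∃ L ∈ A.erase H, L ⊓ H = X := by
    intro X hX
    simpa [restrict] using hX
  choose! r hr hrX using hex
  have hp' : Forms (A.erase H) p := fun L hL => hp L (Finset.mem_of_mem_erase hL)
  have hne : ∀ L ∈ A.erase H, LinearMap.ker (p L) ≠ LinearMap.ker (p H) := by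
    intro L hL
    rw [(hp' L hL).2, (hp H hH).2]
    exact Finset.ne_of_mem_erase hL
  have hrel : ∀ L ∈ A.erase H, ∀ M ∈ A.erase H, L ⊓ H ≠ M ⊓ H →
      IsRelPrime (P.rho (linPoly (p L))) (P.rho (linPoly (p M))) := by
    intro L hL M hM h
    apply P.rho_relprime (hp' L hL).1 (hne L hL) (hp' M hM).1 (hne M hM)
    rwa [(hp' L hL).2, (hp' M hM).2, (hp H hH).2]
  let F : Submodule K (Fin 3 → K) → Finset (Submodule K (Fin 3 → K)) :=
    fun X => (A.erase H).filter (fun L => L ⊓ H = X)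
  have hF : ∀ X L, L ∈ F X ↔ L ∈ A.erase H ∧ L ⊓ H = X := fun X L => Finset.mem_filter
  have hrF : ∀ X ∈ restrict A H, r X ∈ F X := fun X hX => (hF _ _).2 ⟨hr X hX, hrX X hX⟩
  let Q := ∏ X ∈ restrict A H, P.rho (linPoly (p (r X)))
  let B := ∏ X ∈ restrict A H, ∏ L ∈ (F X).erase (r X), P.rho (linPoly (p L))
  have hQB : P.rho (QQ (A.erase H) p) = B * Q := by
    have h1 : (∏ X ∈ restrict A H, ∏ L ∈ F X, P.rho (linPoly (p L))) =
        ∏ L ∈ A.erase H, P.rho (linPoly (p L)) :=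
      Finset.prod_fiberwise_of_maps_to (fun L hL => Finset.mem_image_of_mem _ hL) _
    rw [QQ, map_prod, ← h1, ← Finset.prod_mul_distrib]
    exact Finset.prod_congr rfl fun X hX => (Finset.prod_erase_mul _ _ (hrF X hX)).symm
  have hQ0 : Q ≠ 0 := Finset.prod_ne_zero_iff.2 fun X hX =>
    P.rho_lin_ne (hp' _ (hr X hX)).1 (hne _ (hr X hX))
  have hB0 : B ≠ 0 := Finset.prod_ne_zero_iff.2 fun X hX => Finset.prod_ne_zero_iff.2 fun L hL => by
    have := ((hF _ _).1 (Finset.mem_of_mem_erase hL)).1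
    exact P.rho_lin_ne (hp' _ this).1 (hne _ this)
  have hQh : Q.IsHomogeneous (restrict A H).card := by
    have := IsHomogeneous.prod (restrict A H) (fun X => P.rho (linPoly (p (r X)))) (fun _ => 1)
      (fun L _ => P.rho_hom (linPoly_hom _))
    simpa [Q] using this
  have hBh := (hom_div (P.rho_hom (QQ_hom (A.erase H) p)) hQh hQ0 (hQB.trans (mul_comm _ _))).1
  have hcard : (restrict A H).card ≤ (A.erase H).card := Finset.card_image_le
  refine ⟨Q, B, _, hQ0, hB0, hQh, hBh, by omega, hQB, fun θ hθ => ?_, fun θ hθ => ?_⟩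
  · refine Finset.prod_dvd_of_isRelPrime ?_ ?_
    · intro X hX Y hY hXY
      exact hrel _ (hr X hX) _ (hr Y hY) (by rwa [hrX X hX, hrX Y hY])
    · intro X hX
      have h1 := (inD_iff hp θ).1 hθ
      exact P.lam_dvd (h1 H hH) (h1 _ (Finset.mem_of_mem_erase (hr X hX))) (hp' _ (hr X hX)).1
        (hne _ (hr X hX))
  · refine Finset.prod_dvd_of_isRelPrime ?_ ?_
    · intro X hX Y hY hXY
      refine IsRelPrime.prod_left fun L hL => IsRelPrime.prod_right fun M hM => ?_
      obtain ⟨hL', rfl⟩ := (hF _ _).1 (Finset.mem_of_mem_erase hL)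
      obtain ⟨hM', rfl⟩ := (hF _ _).1 (Finset.mem_of_mem_erase hM)
      exact hrel _ hL' _ hM' hXY
    · intro X hX
      have h1 := (inD_iff hp' θ).1 hθ
      have h2 : (∏ L ∈ F X, linPoly (p L)) ∣
          linPoly (p H) * ap (p (r X)) θ - linPoly (p (r X)) * ap (p H) θ := by
        refine Finset.prod_dvd_of_isRelPrime ?_ ?_
        · intro L hL M hM hLM
          exact forms_relprime hp' ((hF _ _).1 hL).1 ((hF _ _).1 hM).1 hLM
        · intro L hL
          obtain ⟨hL, hLX⟩ := (hF _ _).1 hL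
          obtain ⟨c, b, hc, he⟩ := P.same_rest (ψ := p L) (hp' _ (hr X hX)).1 (hne _ (hr X hX))
            (by rw [(hp' L hL).2, (hp' _ (hr X hX)).2, (hp H hH).2, hLX, hrX X hX])
          have e1 : linPoly (p L) = C c * linPoly (p (r X)) + C b * linPoly (p H) := by
            rw [linPoly_eq, he, ap_add_dual, ap_smul_dual, ap_smul_dual]; rfl
          have e2 : ap (p L) θ = C c * ap (p (r X)) θ + C b * ap (p H) θ := by
            rw [he, ap_add_dual, ap_smul_dual, ap_smul_dual]
          have hu : IsUnit (C c : MvPolynomial (Fin 3) K) := (isUnit_iff_ne_zero.2 hc).map C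
          rw [← hu.dvd_mul_left]
          have e3 : C c * (linPoly (p H) * ap (p (r X)) θ - linPoly (p (r X)) * ap (p H) θ) =
            linPoly (p H) * ap (p L) θ - linPoly (p L) * ap (p H) θ := by
            rw [e1, e2]; ring
          rw [e3]
          exact dvd_sub ((h1 L hL).mul_left _) (dvd_mul_right _ _)
      have h3 := map_dvd P.rho h2
      rw [map_sub, map_mul, map_mul, P.rho_self, zero_mul, zero_sub, dvd_neg, map_prod,
        ← Finset.mul_prod_erase _ _ (hrF X hX)] at h3
      exact (mul_dvd_mul_iff_left (P.rho_lin_ne (hp' _ (hr X hX)).1 (hne _ (hr X hX)))).1 h3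


lemma euler_coefs {n : ℕ} {θ : Fin n → Deriv K 3} {e : Fin n → ℕ}
    (hθ : ∀ i, HomogDeriv (θ i) (e i)) (he : ∀ i, 1 ≤ e i) {c : Fin n → MvPolynomial (Fin 3) K}
    (h : eulerD = ∑ i, c i • θ i) : ∃ c' : Fin n → K, eulerD = ∑ i, (C (c' i) : MvPolynomial (Fin 3) K) • θ i ∧
      (∀ i, c' i ≠ 0 → e i = 1) ∧ ∃ i, c' i ≠ 0 := by
  have key : (eulerD : Deriv K 3) =
      ∑ i, (C (if e i = 1 then constantCoeff (c i) else 0) : MvPolynomial (Fin 3) K) • θ i := by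
    funext j
    have h1 := congrFun h j
    have h2 := congrArg (homogeneousComponent 1) h1
    rw [homogeneousComponent_eq_self (euler_hom j)] at h2
    rw [h2, Finset.sum_apply, Finset.sum_apply, map_sum]
    refine Finset.sum_congr rfl fun i _ => ?_
    simp only [Pi.smul_apply, smul_eq_mul]
    rw [hc_mul (hθ i j)]
    by_cases h3 : e i = 1
    · rw [h3]; simp [constantCoeff_eq]
    · have := he i
      rw [if_neg (by omega), if_neg h3]; simp
  refine ⟨_, key, fun i hi => ?_, ?_⟩
  · by_contra h3
    simp [h3] at hi
  · by_contra hcon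
    push Not at hcon
    have := congrFun key 0
    simp only [hcon] at this
    simp [eulerD] at this

lemma free_of_saito {A : Finset (Submodule K (Fin 3 → K))} {p} (hp : Forms A p) {a b c : Deriv K 3}
    (ha : InD A a) (hb : InD A b) (hc : InD A c) {l m n : ℕ} (hla : HomogDeriv a l)
    (hmb : HomogDeriv b m) (hnc : HomogDeriv c n) {k : K} (hk : k ≠ 0)
    (h : D3 a b c = C k * QQ A p) : IsFreeExp A ![l, m, n] := by
  refine ⟨![a, b, c], ?_, ⟨?_, ?_⟩, ?_⟩
  · intro i; fin_cases i
    · exact hla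
    · exact hmb
    · exact hnc
  · intro i; fin_cases i
    · exact ha
    · exact hb
    · exact hc
  · intro η hη
    obtain ⟨x, y, z, hh⟩ := saito_conv hp ha hb hc hk h η hη
    exact ⟨![x, y, z], by simp [Fin.sum_univ_three, hh]⟩
  · intro q hq
    have h0 : D3 a b c ≠ 0 := by
      rw [h]; exact mul_ne_zero (by simpa using hk) (QQ_ne hp)
    simp only [Fin.sum_univ_three] at hq
    obtain ⟨h1, h2, h3⟩ := D3_indep h0 hq
    intro i; fin_cases i
    · exact h1
    · exact h2
    · exact h3

lemma inD_insert {A : Finset (Submodule K (Fin 3 → K))} {p} (hp : Forms A p)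
    {H : Submodule K (Fin 3 → K)} {θ : Deriv K 3} (h : InD (A.erase H) θ)
    (h' : linPoly (p H) ∣ ap (p H) θ) : InD A θ := by
  rw [inD_iff hp]
  have hp' : Forms (A.erase H) p := fun L hL => hp L (Finset.mem_of_mem_erase hL)
  rw [inD_iff hp'] at h
  intro L hL
  by_cases hLH : L = H
  · rw [hLH]; exact h'
  · exact h L (Finset.mem_erase.2 ⟨hLH, hL⟩)

lemma inD_erase {A : Finset (Submodule K (Fin 3 → K))}
    {H : Submodule K (Fin 3 → K)} {θ : Deriv K 3} (h : InD A θ) : InD (A.erase H) θ :=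
  fun L hL => h L (Finset.mem_of_mem_erase hL)

lemma unit_case {A : Finset (Submodule K (Fin 3 → K))} {p} (hp : Forms A p)
    {H : Submodule K (Fin 3 → K)} (hH : H ∈ A) {a0 a1 a2 : Deriv K 3}
    (h0 : InD (A.erase H) a0) (h1 : InD (A.erase H) a1) (h2 : InD (A.erase H) a2)
    {e0 e1 e2 : ℕ} (hd0 : HomogDeriv a0 e0) (hd1 : HomogDeriv a1 e1) (hd2 : HomogDeriv a2 e2)
    {k : K} (hk : k ≠ 0) (hdet : D3 a0 a1 a2 = C k * QQ (A.erase H) p)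
    {g1 g2 : MvPolynomial (Fin 3) K} (hg1 : HomogDeriv (g1 • a0) e1) (hg2 : HomogDeriv (g2 • a0) e2)
    (hv1 : linPoly (p H) ∣ ap (p H) (a1 - g1 • a0))
    (hv2 : linPoly (p H) ∣ ap (p H) (a2 - g2 • a0)) : IsFree A := by
  refine ⟨_, free_of_saito hp (a := linPoly (p H) • a0) (b := a1 - g1 • a0) (c := a2 - g2 • a0)
    (inD_insert hp (h0.smul _) ?_) (inD_insert hp (h1.sub (h0.smul _)) hv1)
    (inD_insert hp (h2.sub (h0.smul _)) hv2) (hd0.smul (linPoly_hom _) rfl) (hd1.sub hg1)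
    (hd2.sub hg2) hk ?_⟩
  · rw [map_smul]; exact dvd_mul_right _ _
  · have e1 : D3 (linPoly (p H) • a0) (a1 - g1 • a0) (a2 - g2 • a0) =
        linPoly (p H) * D3 a0 a1 a2 := by
      simp only [D3, Pi.sub_apply, Pi.smul_apply, smul_eq_mul]; ring
    rw [e1, hdet, QQ, QQ, ← Finset.mul_prod_erase _ _ hH]
    ring

lemma deg_zero_case {A : Finset (Submodule K (Fin 3 → K))} {p} (hp : Forms A p) (hEss : Essential A)
    {H : Submodule K (Fin 3 → K)} (hH : H ∈ A) {a0 a1 a2 : Deriv K 3}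
    (h0 : InD (A.erase H) a0) (h1 : InD (A.erase H) a1) (h2 : InD (A.erase H) a2)
    {e1 e2 : ℕ} (hd0 : HomogDeriv a0 0) (hd1 : HomogDeriv a1 e1) (hd2 : HomogDeriv a2 e2)
    {k : K} (hk : k ≠ 0) (hdet : D3 a0 a1 a2 = C k * QQ (A.erase H) p) : IsFree A := by
  have hp' : Forms (A.erase H) p := fun L hL => hp L (Finset.mem_of_mem_erase hL)
  set c := constantCoeff (ap (p H) a0) with hc
  have hap : ap (p H) a0 = C c := hom_zero_eq_C (ap_hom hd0)
  by_cases hc0 : c = 0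
  · exfalso
    have hin : InD A a0 := inD_insert hp h0 (by rw [hap, hc0]; simp)
    have hv : a0 = cst (fun i => constantCoeff (a0 i)) := funext fun i => hom_zero_eq_C (hd0 i)
    set v : Fin 3 → K := fun i => constantCoeff (a0 i)
    have hmem : v ∈ A.inf id := by
      rw [Submodule.mem_finsetInf]
      intro L hL
      have h3 := (inD_iff hp a0).1 hin L hL
      rw [hv, ap_cst] at h3
      change v ∈ L
      rw [← (hp L hL).2, LinearMap.mem_ker]
      by_contra h4
      exact (linPoly_irr (hp L hL).1).not_isUnit
        (isUnit_of_dvd_unit h3 ((isUnit_iff_ne_zero.2 h4).map C))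
    rw [hEss, Submodule.mem_bot] at hmem
    have h5 : a0 = 0 := by rw [hv, hmem]; funext i; simp [cst]
    rw [h5] at hdet
    have : D3 (0 : Deriv K 3) a1 a2 = 0 := by simp [D3]
    rw [this] at hdet
    exact mul_ne_zero (by simpa using hk) (QQ_ne hp') hdet.symm
  · have hz : ∀ a : Deriv K 3,
        linPoly (p H) ∣ ap (p H) (a - (C c⁻¹ * ap (p H) a) • a0) := by
      intro a
      have : ap (p H) (a - (C c⁻¹ * ap (p H) a) • a0) = 0 := by
        rw [map_sub, map_smul, hap, smul_eq_mul]
        have : (C c⁻¹ * C c : MvPolynomial (Fin 3) K) = 1 := by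
          rw [← C_mul, inv_mul_cancel₀ hc0, C_1]
        linear_combination (- ap (p H) a) * this
      rw [this]; simp
    exact unit_case hp hH h0 h1 h2 hd0 hd1 hd2 hk hdet
      (hd0.smul ((ap_hom hd1).C_mul _) rfl) (hd0.smul ((ap_hom hd2).C_mul _) rfl) (hz a1) (hz a2)

lemma unit_f {A : Finset (Submodule K (Fin 3 → K))} {p} (hp : Forms A p)
    {H : Submodule K (Fin 3 → K)} (hH : H ∈ A) (P : HP (p H)) {a0 a1 : Deriv K 3}
    (h0 : InD (A.erase H) a0) (h1 : InD (A.erase H) a1)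
    {e0 e1 : ℕ} (hd0 : HomogDeriv a0 e0) (hd1 : HomogDeriv a1 e1)
    {k : K} (hk : k ≠ 0) (hdet : D3 a0 a1 eulerD = C k * QQ (A.erase H) p)
    {B f0 f1 : MvPolynomial (Fin 2) K} {b : ℕ} (hB : B.IsHomogeneous b) (hB0 : B ≠ 0)
    (hf0 : P.rho (ap (p H) a0) = B * f0) (hf1 : P.rho (ap (p H) a1) = B * f1)
    (hu : IsUnit f0) : IsFree A := by
  obtain ⟨q0, q0'⟩ := hom_div (P.rho_hom (ap_hom hd0)) hB hB0 hf0
  obtain ⟨q1, q1'⟩ := hom_div (P.rho_hom (ap_hom hd1)) hB hB0 hf1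
  have hge : b ≤ e0 := by
    by_contra hlt
    exact hu.ne_zero (q0' (by omega))
  have heq : e0 - b = 0 := by
    by_contra hlt
    have := hu.map (constantCoeff (R := K) (σ := Fin 2))
    rw [hom_cc q0 (by omega)] at this
    simp at this
  rw [heq] at q0
  have hc := hom_zero_eq_C q0
  set c := constantCoeff f0
  have hc0 : c ≠ 0 := by
    intro h; rw [h] at hc; apply hu.ne_zero; rw [hc]; simp
  have hcc : (C c⁻¹ * C c : MvPolynomial (Fin 2) K) = 1 := by
    rw [← C_mul, inv_mul_cancel₀ hc0, C_1]
  refine unit_case hp hH h0 h1 (inD_euler _) hd0 hd1 euler_hom hk hdet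
    (g1 := P.sig (C c⁻¹ * f1)) (g2 := 0) ?_ ?_ ?_ ?_
  · by_cases hlt : e1 < b
    · rw [q1' hlt]; simp only [mul_zero, map_zero, zero_smul]
      exact fun i => isHomogeneous_zero _ _ _
    · exact hd0.smul (P.sig_hom (q1.C_mul _)) (by omega)
  · rw [zero_smul]; exact fun i => isHomogeneous_zero _ _ _
  · rw [← P.rho_eq_zero, map_sub, map_smul, smul_eq_mul, map_sub, map_mul, P.rho_sig, hf0, hf1, hc]
    linear_combination (- B * f1) * hcc
  · rw [zero_smul, sub_zero]; exact dvd_refl (linPoly (p H))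


lemma fwd_main {A : Finset (Submodule K (Fin 3 → K))} {p} (hp : Forms A p) (hnf : ¬ IsFree A)
    {H : Submodule K (Fin 3 → K)} (hH : H ∈ A) {a1 a2 : Deriv K 3}
    (h1 : InD (A.erase H) a1) (h2 : InD (A.erase H) a2)
    {d1 d2 : ℕ} (hd1 : HomogDeriv a1 d1) (hd2 : HomogDeriv a2 d2)
    {k : K} (hk : k ≠ 0) (hdet : D3 eulerD a1 a2 = C k * QQ (A.erase H) p) :
    ∃ d : ℕ, (d : ℤ) = ((restrict A H).card : ℤ) - 1 ∧
        IsSPOG A ![1, d1 + 1, d2 + 1] d := by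
  have hp' : Forms (A.erase H) p := fun L hL => hp L (Finset.mem_of_mem_erase hL)
  obtain ⟨P⟩ := exists_HP (hp H hH).1
  obtain ⟨Q, B, b, hQ0, hB0, hQh, hBh, hcard, hQB, hQd, hBd⟩ := exists_rep hp hH P
  have hD0 : D3 eulerD a1 a2 ≠ 0 := by
    rw [hdet]; exact mul_ne_zero (by simpa using hk) (QQ_ne hp')
  have hdeg : 1 + d1 + d2 = (A.erase H).card := by
    refine IsHomogeneous.inj_right (D3_hom euler_hom hd1 hd2) ?_ hD0
    rw [hdet]
    exact (QQ_hom _ _).C_mul _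
  obtain ⟨f1, hf1⟩ := hBd a1 h1
  obtain ⟨f2, hf2⟩ := hBd a2 h2
  obtain ⟨q1, q1'⟩ := hom_div (P.rho_hom (ap_hom hd1)) hBh hB0 hf1
  obtain ⟨q2, q2'⟩ := hom_div (P.rho_hom (ap_hom hd2)) hBh hB0 hf2
  obtain ⟨κ, hκ, hdr⟩ := P.det_rho
  have hlam : f2 * P.lam a1 - f1 * P.lam a2 = C (κ * k) * Q := by
    apply mul_left_cancel₀ hB0
    have := hdr a1 a2
    rw [hdet, map_mul, P.rho_C, hQB, hf1, hf2] at this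
    rw [C_mul]
    linear_combination -this
  have hκk : κ * k ≠ 0 := mul_ne_zero hκ hk
  have hα0 : linPoly (p H) ≠ 0 := linPoly_ne (hp H hH).1
  have hinD : ∀ x1 x2 : MvPolynomial (Fin 2) K, x1 * f1 + x2 * f2 = 0 →
      InD A (P.sig x1 • a1 + P.sig x2 • a2) := by
    intro x1 x2 hx
    refine inD_insert hp ((h1.smul _).add (h2.smul _)) ?_
    rw [← P.rho_eq_zero, map_add, map_smul, map_smul, map_add, smul_eq_mul, smul_eq_mul, map_mul,
      map_mul, P.rho_sig, P.rho_sig, hf1, hf2]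
    linear_combination B * hx
  have hrel : IsRelPrime f1 f2 := by
    rintro g ⟨y1, hy1⟩ ⟨y2, hy2⟩
    have hg0 : g ≠ 0 := by
      rintro rfl
      rw [hy1, hy2] at hlam
      simp only [zero_mul, sub_zero] at hlam
      exact mul_ne_zero (by simpa using hκk) hQ0 hlam.symm
    obtain ⟨z, hz⟩ := hQd _ (hinD y2 (-y1) (by rw [hy1, hy2]; ring))
    rw [P.lam_add, P.lam_smul, P.lam_smul, P.rho_sig, P.rho_sig] at hz
    have h3 : g * z = C (κ * k) := by
      apply mul_right_cancel₀ hQ0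
      rw [← hlam, hy1, hy2]
      linear_combination -g * hz
    exact isUnit_of_dvd_unit ⟨z, h3.symm⟩ ((isUnit_iff_ne_zero.2 hκk).map C)
  have hu1 : ¬ IsUnit f1 := fun hu => hnf <| unit_f hp hH P h1 h2 hd1 hd2 hk
    (by rw [← D3_cyc]; exact hdet) hBh hB0 hf1 hf2 hu
  have hu2 : ¬ IsUnit f2 := fun hu => hnf <| unit_f hp hH P h2 h1 hd2 hd1 (neg_ne_zero.2 hk)
    (by rw [← D3_cyc, D3_swap', hdet]; simp) hBh hB0 hf2 hf1 hu
  have hf10 : f1 ≠ 0 := by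
    intro h; rw [h, isRelPrime_zero_left] at hrel; exact hu2 hrel
  have hf20 : f2 ≠ 0 := by
    intro h; rw [h, isRelPrime_zero_right] at hrel; exact hu1 hrel
  have hpos : ∀ (f : MvPolynomial (Fin 2) K) (n : ℕ), f.IsHomogeneous (n - b) → (n < b → f = 0) →
      f ≠ 0 → ¬ IsUnit f → b < n := by
    intro f n hf hf' hf0 hfu
    by_contra hlt
    have h3 : ¬ n < b := fun h => hf0 (hf' h)
    have h4 : n - b = 0 := by omega
    rw [h4] at hf
    have h5 := hom_zero_eq_C hf
    have h6 : constantCoeff f ≠ 0 := by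
      intro h; rw [h] at h5; apply hf0; rw [h5]; simp
    apply hfu
    rw [h5]
    exact (isUnit_iff_ne_zero.2 h6).map C
  have hb1 := hpos f1 d1 q1 q1' hf10 hu1
  have hb2 := hpos f2 d2 q2 q2' hf20 hu2
  have hφ : InD A (P.sig f2 • a1 - P.sig f1 • a2) := by
    have := hinD f2 (-f1) (by ring)
    rwa [map_neg, neg_smul, ← sub_eq_add_neg] at this
  have hαD : ∀ a, InD (A.erase H) a → InD A (linPoly (p H) • a) := fun a ha =>
    inD_insert hp (ha.smul _) (by rw [map_smul]; exact dvd_mul_right _ _)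
  refine ⟨d1 + d2 - b, by omega, ![eulerD, linPoly (p H) • a1, linPoly (p H) • a2],
    P.sig f2 • a1 - P.sig f1 • a2, ![0, - P.sig f2, P.sig f1], linPoly (p H),
    ⟨?_, hφ, ?_, ?_, ?_, linPoly_hom _, ?_, ?_, ?_, ?_, ?_⟩, hα0⟩
  · intro i; fin_cases i
    · exact inD_euler A
    · exact hαD _ h1
    · exact hαD _ h2
  · intro i; fin_cases i
    · exact euler_hom
    · exact hd1.smul (linPoly_hom _) (add_comm _ _)
    · exact hd2.smul (linPoly_hom _) (add_comm _ _)
  · exact (hd1.smul (P.sig_hom q2) (by omega)).sub (hd2.smul (P.sig_hom q1) (by omega))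
  · intro η hη
    obtain ⟨x, y, z, hxyz⟩ := saito_conv hp' (inD_euler _) h1 h2 hk hdet η (inD_erase hη)
    have h3 := (inD_iff hp η).1 hη H hH
    have h4 : P.rho y * f1 + P.rho z * f2 = 0 := by
      rw [← P.rho_eq_zero, hxyz] at h3
      simp only [map_add, map_smul, smul_eq_mul, map_mul, hf1, hf2, ← linPoly_eq, P.rho_self] at h3
      apply mul_left_cancel₀ hB0
      linear_combination h3
    have h5 : f2 ∣ P.rho y := hrel.symm.dvd_of_dvd_mul_right ⟨- P.rho z, by linear_combination h4⟩
    obtain ⟨t, ht⟩ := h5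
    have h6 : P.rho z = - f1 * t := by
      apply mul_left_cancel₀ hf20
      rw [ht] at h4
      linear_combination h4
    obtain ⟨u, hu⟩ := P.sig_rho y
    obtain ⟨v, hv⟩ := P.sig_rho z
    rw [ht, map_mul] at hu
    rw [h6, map_mul, map_neg] at hv
    refine ⟨![x, u, v], P.sig t, ?_⟩
    simp only [Fin.sum_univ_three, Matrix.cons_val]
    funext i
    have h7 := congrFun hxyz i
    simp only [Pi.add_apply, Pi.sub_apply, Pi.smul_apply, smul_eq_mul] at h7 ⊢
    linear_combination h7 + a1 i * hu + a2 i * hv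
  · intro i; fin_cases i
    · exact isHomogeneous_zero _ _ _
    · have h3 : d1 + d2 - b + 1 - (d1 + 1) = d2 - b := by omega
      change (- P.sig f2).IsHomogeneous (d1 + d2 - b + 1 - (d1 + 1))
      rw [h3]; exact (P.sig_hom q2).neg
    · have h3 : d1 + d2 - b + 1 - (d2 + 1) = d1 - b := by omega
      change (P.sig f1).IsHomogeneous (d1 + d2 - b + 1 - (d2 + 1))
      rw [h3]; exact (P.sig_hom q1)
  · intro i; fin_cases i
    · exact map_zero _
    · exact hom_cc (P.sig_hom q2).neg (by omega)
    · exact hom_cc (P.sig_hom q1) (by omega)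
  · simp only [Fin.sum_univ_three, Matrix.cons_val]
    funext i
    simp only [Pi.add_apply, Pi.sub_apply, Pi.smul_apply, smul_eq_mul, Pi.zero_apply]
    ring
  · exact fun h => hα0 h.1
  · intro g h hgh
    simp only [Fin.sum_univ_three, Matrix.cons_val] at hgh
    have h3 : g 0 • eulerD + (g 1 * linPoly (p H) + h * P.sig f2) • a1 +
        (g 2 * linPoly (p H) - h * P.sig f1) • a2 = 0 := by
      rw [← hgh]
      funext i
      simp only [Pi.add_apply, Pi.sub_apply, Pi.smul_apply, smul_eq_mul]
      ring
    obtain ⟨r0, r1, r2⟩ := D3_indep hD0 h3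
    have h4 : linPoly (p H) ∣ h := by
      rw [← P.rho_eq_zero]
      have := congrArg P.rho r1
      rw [map_add, map_mul, map_mul, P.rho_self, P.rho_sig, mul_zero, zero_add, map_zero] at this
      exact (mul_eq_zero.1 this).resolve_right hf20
    obtain ⟨q, rfl⟩ := h4
    refine ⟨q, fun i => ?_, mul_comm _ _⟩
    fin_cases i
    · simpa using r0
    · apply mul_left_cancel₀ hα0
      change linPoly (p H) * g 1 = linPoly (p H) * (q * - P.sig f2)
      linear_combination r1
    · apply mul_left_cancel₀ hα0
      change linPoly (p H) * g 2 = linPoly (p H) * (q * P.sig f1)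
      linear_combination r2

lemma fwd {A : Finset (Submodule K (Fin 3 → K))} (hA : IsArrangement A) (hEss : Essential A)
    (hnf : ¬ IsFree A) {H : Submodule K (Fin 3 → K)} (hH : H ∈ A) {d1 d2 : ℕ}
    (h : IsFreeExp (A.erase H) ![1, d1, d2]) :
    ∃ d : ℕ, (d : ℤ) = ((restrict A H).card : ℤ) - 1 ∧
        IsSPOG A ![1, d1 + 1, d2 + 1] d := by
  obtain ⟨p, hp⟩ := exists_forms hA
  have hp' : Forms (A.erase H) p := fun L hL => hp L (Finset.mem_of_mem_erase hL)
  obtain ⟨θ, hθ, ⟨hin, hgen⟩, -⟩ := h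
  have hh0 : HomogDeriv (θ 0) 1 := hθ 0
  have hh1 : HomogDeriv (θ 1) d1 := hθ 1
  have hh2 : HomogDeriv (θ 2) d2 := hθ 2
  obtain ⟨k, hk, hdet⟩ := saito hp' (hin 0) (hin 1) (hin 2) (fun η hη => by
    obtain ⟨c, hc⟩ := hgen η hη
    exact ⟨c 0, c 1, c 2, by rw [hc, Fin.sum_univ_three]⟩)
  have hd1 : 1 ≤ d1 := by
    by_contra hlt
    have h0 : d1 = 0 := by omega
    rw [h0] at hh1
    exact hnf (deg_zero_case hp hEss hH (hin 1) (hin 2) (hin 0) hh1 hh2 hh0 hk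
      (by rw [← D3_cyc]; exact hdet))
  have hd2 : 1 ≤ d2 := by
    by_contra hlt
    have h0 : d2 = 0 := by omega
    rw [h0] at hh2
    exact hnf (deg_zero_case hp hEss hH (hin 2) (hin 0) (hin 1) hh2 hh0 hh1 hk
      (by rw [D3_cyc]; exact hdet))
  obtain ⟨c, hc⟩ := hgen _ (inD_euler _)
  obtain ⟨c', hE, hce, i, hi⟩ := euler_coefs hθ (fun i => by fin_cases i <;> simp [hd1, hd2]) hc
  have he := hce i hi
  rw [Fin.sum_univ_three] at hE
  have hcong : ∀ j, (eulerD : Deriv K 3) j = C (c' 0) * θ 0 j + C (c' 1) * θ 1 j + C (c' 2) * θ 2 j :=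
    fun j => by rw [hE]; rfl
  fin_cases i
  · refine fwd_main hp hnf hH (hin 1) (hin 2) hh1 hh2 (k := c' 0 * k) (mul_ne_zero hi hk) ?_
    rw [C_mul, mul_assoc, ← hdet]
    simp only [D3, hcong]
    ring
  · have he' : d1 = 1 := he
    rw [← he'] at hh0
    refine fwd_main hp hnf hH (hin 0) (hin 2) hh0 hh2 (k := -(c' 1 * k))
      (neg_ne_zero.2 (mul_ne_zero hi hk)) ?_
    rw [C_neg, C_mul, neg_mul, mul_assoc, ← hdet]
    simp only [D3, hcong]
    ring
  · have he' : d2 = 1 := he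
    rw [← he'] at hh0
    refine fwd_main hp hnf hH (hin 1) (hin 0) hh1 hh0 (k := -(c' 2 * k))
      (neg_ne_zero.2 (mul_ne_zero hi hk)) ?_
    rw [C_neg, C_mul, neg_mul, mul_assoc, ← hdet]
    simp only [D3, hcong]
    ring


/-- normal form of a one-relation presentation containing the Euler derivation -/
structure NF (A : Finset (Submodule K (Fin 3 → K))) (x1 x2 x3 : Deriv K 3)
    (s1 s2 s3 : MvPolynomial (Fin 3) K) : Prop where
  in1 : InD A x1
  in2 : InD A x2
  in3 : InD A x3
  gen : ∀ η, InD A η → ∃ x y1 y2 y3 : MvPolynomial (Fin 3) K,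
    η = x • eulerD + y1 • x1 + y2 • x2 + y3 • x3
  rel : s1 • x1 + s2 • x2 + s3 • x3 = 0
  syz : ∀ x y1 y2 y3 : MvPolynomial (Fin 3) K,
    x • eulerD + y1 • x1 + y2 • x2 + y3 • x3 = 0 →
      ∃ q, x = 0 ∧ y1 = q * s1 ∧ y2 = q * s2 ∧ y3 = q * s3
  cc1 : constantCoeff s1 = 0
  cc2 : constantCoeff s2 = 0
  cc3 : constantCoeff s3 = 0
  ne : ¬ (s1 = 0 ∧ s2 = 0 ∧ s3 = 0)

namespace NF
variable {A : Finset (Submodule K (Fin 3 → K))} {x1 x2 x3 : Deriv K 3}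
  {s1 s2 s3 : MvPolynomial (Fin 3) K}

lemma rot (N : NF A x1 x2 x3 s1 s2 s3) : NF A x2 x3 x1 s2 s3 s1 where
  in1 := N.in2
  in2 := N.in3
  in3 := N.in1
  gen η hη := by
    obtain ⟨x, y1, y2, y3, h⟩ := N.gen η hη
    exact ⟨x, y2, y3, y1, by rw [h]; abel⟩
  rel := by rw [← N.rel]; abel
  syz x y1 y2 y3 h := by
    obtain ⟨q, h0, h1, h2, h3⟩ := N.syz x y3 y1 y2 (by rw [← h]; abel)
    exact ⟨q, h0, h2, h3, h1⟩
  cc1 := N.cc2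
  cc2 := N.cc3
  cc3 := N.cc1
  ne h := N.ne ⟨h.2.2, h.1, h.2.1⟩

lemma indep (N : NF A x1 x2 x3 s1 s2 s3) {p} (hp : Forms A p) (a b : K) :
    s3 ≠ C a * s1 + C b * s2 := by
  intro hs
  have hrel : ∀ j, s1 * (x1 j + C a * x3 j) + s2 * (x2 j + C b * x3 j) = 0 := by
    intro j
    have := congrFun N.rel j
    simp only [Pi.add_apply, Pi.smul_apply, smul_eq_mul, hs, Pi.zero_apply] at this
    linear_combination this
  by_cases h2 : s2 = 0
  · have h1 : s1 ≠ 0 := by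
      rintro rfl
      exact N.ne ⟨rfl, h2, by rw [hs, h2]; simp⟩
    obtain ⟨q, -, hq, -⟩ := N.syz 0 1 0 (C a) (by
      funext j
      have := hrel j
      rw [h2, zero_mul, add_zero] at this
      have := (mul_eq_zero.1 this).resolve_left h1
      simp only [Pi.add_apply, Pi.smul_apply, smul_eq_mul, Pi.zero_apply]
      linear_combination this)
    have := congrArg constantCoeff hq
    rw [map_mul, N.cc1] at this
    simp at this
  · have hco : IsRelPrime s1 s2 := by
      rintro g ⟨t1, h1⟩ ⟨t2, h2'⟩
      have hg0 : g ≠ 0 := by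
        rintro rfl; rw [zero_mul] at h2'; exact h2 h2'
      obtain ⟨q, -, -, hq, -⟩ := N.syz 0 t1 t2 (C a * t1 + C b * t2) (by
        funext j
        have := hrel j
        rw [h1, h2'] at this
        simp only [Pi.add_apply, Pi.smul_apply, smul_eq_mul, Pi.zero_apply]
        apply mul_left_cancel₀ hg0
        linear_combination this)
      have ht : t2 ≠ 0 := by
        rintro rfl; rw [mul_zero] at h2'; exact h2 h2'
      have : 1 = g * q := by
        apply mul_left_cancel₀ ht
        rw [h2'] at hq
        linear_combination hq
      exact isUnit_of_dvd_one ⟨q, this⟩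
    have hdv : ∀ j, ∃ z, x1 j + C a * x3 j = s2 * z := fun j =>
      hco.symm.dvd_of_dvd_mul_left ⟨-(x2 j + C b * x3 j), by linear_combination hrel j⟩
    choose ζ hζ using hdv
    have hζ2 : ∀ j, x2 j + C b * x3 j = - s1 * ζ j := by
      intro j
      apply mul_left_cancel₀ h2
      have := hrel j
      rw [hζ j] at this
      linear_combination this
    have i1 : InD A (s2 • ζ) := by
      have : s2 • ζ = x1 + (C a : MvPolynomial (Fin 3) K) • x3 := by
        funext j
        simp only [Pi.add_apply, Pi.smul_apply, smul_eq_mul]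
        rw [hζ j]
      rw [this]; exact N.in1.add (N.in3.smul _)
    have i2 : InD A (s1 • ζ) := by
      have : s1 • ζ = (-1 : MvPolynomial (Fin 3) K) • (x2 + (C b : MvPolynomial (Fin 3) K) • x3) := by
        funext j
        simp only [Pi.add_apply, Pi.smul_apply, smul_eq_mul]
        rw [hζ2 j]; ring
      rw [this]; exact (N.in2.add (N.in3.smul _)).smul _
    have hin : InD A ζ := by
      rw [inD_iff hp] at i1 i2 ⊢
      intro L hL
      have j1 := i1 L hL
      have j2 := i2 L hL
      have hpr := (linPoly_irr (hp L hL).1).prime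
      rw [map_smul, smul_eq_mul] at j1 j2
      rcases hpr.dvd_or_dvd j1 with h | h
      · rcases hpr.dvd_or_dvd j2 with h' | h'
        · exact absurd (hco h' h) hpr.not_isUnit
        · exact h'
      · exact h
    obtain ⟨x, y1, y2, y3, hy⟩ := N.gen ζ hin
    obtain ⟨q, -, hq1, hq2, -⟩ := N.syz (- s2 * x) (1 - y1 * s2 + y2 * s1) 0
      ((1 - y1 * s2 + y2 * s1) * C a - s2 * (y3 - C a * y1 - C b * y2)) (by
        funext j
        have h3 := congrFun hy j
        have h4 := hζ j
        have h5 := hζ2 j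
        simp only [Pi.add_apply, Pi.smul_apply, smul_eq_mul, Pi.zero_apply] at h3 ⊢
        linear_combination s2 * h3 + (1 - y1 * s2 + y2 * s1) * h4 + s2 * y1 * h4 + s2 * y2 * h5)
    have hq0 : q = 0 := (mul_eq_zero.1 hq2.symm).resolve_right h2
    rw [hq0, zero_mul] at hq1
    have := congrArg constantCoeff hq1
    simp [N.cc1, N.cc2] at this

lemma dets (N : NF A x1 x2 x3 s1 s2 s3) {p} (hp : Forms A p) :
    ∃ q : K, q ≠ 0 ∧ D3 eulerD x2 x3 = C q * QQ A p * s1 ∧ D3 eulerD x3 x1 = C q * QQ A p * s2 ∧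
      D3 eulerD x1 x2 = C q * QQ A p * s3 := by
  obtain ⟨m1, h1⟩ := D3_dvd hp (inD_euler A) N.in2 N.in3
  obtain ⟨m2, h2⟩ := D3_dvd hp (inD_euler A) N.in3 N.in1
  obtain ⟨m3, h3⟩ := D3_dvd hp (inD_euler A) N.in1 N.in2
  obtain ⟨n, hn⟩ := D3_dvd hp N.in1 N.in2 N.in3
  obtain ⟨q, hn0, r1, r2, r3⟩ := N.syz (-n) m1 m2 m3 (by
    funext j
    apply mul_left_cancel₀ (QQ_ne hp)
    have hcr := congrFun (D3_cramer x1 x2 x3 eulerD) j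
    have c2 : D3 x1 eulerD x3 = D3 eulerD x3 x1 := by rw [D3_cyc]
    have c3 : D3 x1 x2 eulerD = D3 eulerD x1 x2 := by rw [D3_cyc, D3_cyc]
    simp only [Pi.add_apply, Pi.smul_apply, smul_eq_mul, Pi.zero_apply, c2, c3, h1, h2, h3, hn]
      at hcr ⊢
    linear_combination - hcr)
  have hn' : n = 0 := neg_eq_zero.1 hn0
  have hspan : ∀ a, InD A a → ∃ r : Fin 4 → MvPolynomial (Fin 3) K,
      a = ∑ i, r i • (![eulerD, x1, x2, x3] : Fin 4 → Deriv K 3) i := by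
    intro a ha
    obtain ⟨x, y1, y2, y3, h⟩ := N.gen a ha
    exact ⟨![x, y1, y2, y3], by simp [Fin.sum_univ_four, h]⟩
  have hu : IsUnit q := by
    apply unit_of_dvd hp
    intro a b c ha hb hc
    refine D3_dvd_span ![eulerD, x1, x2, x3] _ ?_ a b c (hspan a ha) (hspan b hb) (hspan c hc)
    intro i j k hij hjk
    have cases4 : ∀ i j k : Fin 4, i < j → j < k → (i = 0 ∧ j = 1 ∧ k = 2) ∨ (i = 0 ∧ j = 1 ∧ k = 3) ∨ (i = 0 ∧ j = 2 ∧ k = 3) ∨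
        (i = 1 ∧ j = 2 ∧ k = 3) := by decide
    rcases cases4 i j k hij hjk with ⟨rfl, rfl, rfl⟩ | ⟨rfl, rfl, rfl⟩ | ⟨rfl, rfl, rfl⟩ | ⟨rfl, rfl, rfl⟩
    · change _ ∣ D3 eulerD x1 x2
      rw [h3, r3]; exact ⟨s3, by ring⟩
    · change _ ∣ D3 eulerD x1 x3
      rw [D3_swap', h2, r2]; exact ⟨-s2, by ring⟩
    · change _ ∣ D3 eulerD x2 x3
      rw [h1, r1]; exact ⟨s1, by ring⟩
    · change _ ∣ D3 x1 x2 x3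
      rw [hn, hn', mul_zero]; exact dvd_zero _
  rw [isUnit_iff_eq_C_of_isReduced] at hu
  obtain ⟨c, hc, rfl⟩ := hu
  exact ⟨c, hc.ne_zero, by rw [h1, r1]; ring, by rw [h2, r2]; ring, by rw [h3, r3]; ring⟩

end NF

lemma bwd_final {A : Finset (Submodule K (Fin 3 → K))} {p} (hp : Forms A p)
    {H : Submodule K (Fin 3 → K)} (hH : H ∈ A) (P : HP (p H)) {y1 y2 : Deriv K 3}
    (h1 : InD A y1) (h2 : InD A y2) {d1 d2 : ℕ} (hd1 : HomogDeriv y1 (d1 + 1))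
    (hd2 : HomogDeriv y2 (d2 + 1)) (hl1 : P.lam y1 = 0) (hl2 : P.lam y2 = 0)
    (hD : D3 eulerD y1 y2 ≠ 0) (hcard : A.card = d1 + d2 + 2) :
    IsFreeExp (A.erase H) ![1, d1, d2] := by
  have hp' : Forms (A.erase H) p := fun L hL => hp L (Finset.mem_of_mem_erase hL)
  have key : ∀ (y z : Deriv K 3) (g : MvPolynomial (Fin 3) K), InD A y →
      y = g • eulerD + linPoly (p H) • z → InD (A.erase H) z := by
    intro y z g hy he
    have h3 : InD (A.erase H) (linPoly (p H) • z) := by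
      have : linPoly (p H) • z = y - g • eulerD := by rw [he]; abel
      rw [this]
      exact (inD_erase hy).sub ((inD_euler _).smul _)
    rw [inD_iff hp'] at h3 ⊢
    intro L hL
    have h4 := h3 L hL
    rw [map_smul, smul_eq_mul] at h4
    exact (forms_relprime hp (Finset.mem_of_mem_erase hL) hH
      (Finset.ne_of_mem_erase hL)).dvd_of_dvd_mul_left h4
  obtain ⟨g1, z1, he1, hz1⟩ := P.lam_zero hd1 ((inD_iff hp y1).1 h1 H hH) hl1
  obtain ⟨g2, z2, he2, hz2⟩ := P.lam_zero hd2 ((inD_iff hp y2).1 h2 H hH) hl2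
  have i1 := key y1 z1 g1 h1 he1
  have i2 := key y2 z2 g2 h2 he2
  have hDD : D3 eulerD y1 y2 = linPoly (p H) ^ 2 * D3 eulerD z1 z2 := by
    rw [he1, he2]
    simp only [D3, Pi.add_apply, Pi.smul_apply, smul_eq_mul]; ring
  have hz0 : D3 eulerD z1 z2 ≠ 0 := by
    intro h; rw [h, mul_zero] at hDD; exact hD hDD
  obtain ⟨m, hm⟩ := D3_dvd hp' (inD_euler _) i1 i2
  obtain ⟨hm1, hm2⟩ := hom_div (D3_hom euler_hom hz1 hz2) (QQ_hom _ p) (QQ_ne hp') hm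
  have hc' : (A.erase H).card = d1 + d2 + 1 := by
    rw [Finset.card_erase_of_mem hH]; omega
  have h0 : 1 + d1 + d2 - (A.erase H).card = 0 := by omega
  rw [h0] at hm1
  have hmC := hom_zero_eq_C hm1
  have hk : constantCoeff m ≠ 0 := by
    intro h; rw [h] at hmC; rw [hmC] at hm; simp at hm; exact hz0 hm
  refine free_of_saito hp' (inD_euler _) i1 i2 euler_hom hz1 hz2 hk ?_
  rw [hm, ← hmC, mul_comm]


lemma bwd_core {A : Finset (Submodule K (Fin 3 → K))} {p} (hp : Forms A p)
    {H : Submodule K (Fin 3 → K)} (hH : H ∈ A) {x1 x2 x3 : Deriv K 3}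
    {s1 s2 s3 : MvPolynomial (Fin 3) K} (N : NF A x1 x2 x3 s1 s2 s3) {d1 d2 d : ℕ}
    (hd1 : HomogDeriv x1 (d1 + 1)) (hd2 : HomogDeriv x2 (d2 + 1)) (hd3 : HomogDeriv x3 d)
    (hs1 : s1.IsHomogeneous (d + 1 - (d1 + 1))) (hs2 : s2.IsHomogeneous (d + 1 - (d2 + 1)))
    (hs3 : s3.IsHomogeneous (d + 1 - d)) (hd : d + 1 = (restrict A H).card) :
    IsFreeExp (A.erase H) ![1, d1, d2] := by
  obtain ⟨P⟩ := exists_HP (hp H hH).1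
  obtain ⟨Q, -, -, hQ0, -, hQh, -, -, -, hQd, -⟩ := exists_rep hp hH P
  obtain ⟨q, hq, D1, D2, D3'⟩ := N.dets hp
  have hne1 : s1 ≠ 0 := by
    have := N.rot.indep hp 0 0
    simpa using this
  have hne2 : s2 ≠ 0 := by
    have := N.rot.rot.indep hp 0 0
    simpa using this
  have hne3 : s3 ≠ 0 := by
    have := N.indep hp 0 0
    simpa using this
  have hle : ∀ (s : MvPolynomial (Fin 3) K) (e : ℕ), s.IsHomogeneous (d + 1 - e) →
      constantCoeff s = 0 → s ≠ 0 → e ≤ d := by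
    intro s e hs hc h0
    by_contra hlt
    have h3 : d + 1 - e = 0 := by omega
    rw [h3] at hs
    apply h0
    rw [hom_zero_eq_C hs, hc, C_0]
  have hle1 := hle s1 _ hs1 N.cc1 hne1
  have hle2 := hle s2 _ hs2 N.cc2 hne2
  have hqQ : C q * QQ A p ≠ 0 := mul_ne_zero (by simpa using hq) (QQ_ne hp)
  have hcard : A.card = d1 + d2 + 2 := by
    have h3 : D3 eulerD x1 x2 ≠ 0 := by rw [D3']; exact mul_ne_zero hqQ hne3
    have h4 := IsHomogeneous.inj_right (D3_hom euler_hom hd1 hd2)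
      (by rw [D3']; exact ((QQ_hom A p).C_mul q).mul hs3) h3
    omega
  have hlam : ∀ (x : Deriv K 3) (e : ℕ), InD A x → HomogDeriv x e → e ≤ d →
      ∃ c : K, P.lam x = Q * C c ∧ (c ≠ 0 → e = d) := by
    intro x e hx he hed
    obtain ⟨t, ht⟩ := hQd x hx
    obtain ⟨k1, k2⟩ := hom_div (P.lam_hom he) hQh hQ0 ht
    have h3 : 1 + e - (restrict A H).card = 0 := by omega
    rw [h3] at k1
    have h4 := hom_zero_eq_C k1
    refine ⟨constantCoeff t, by rw [← h4]; exact ht, fun hc => ?_⟩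
    by_contra hne
    rw [k2 (by omega)] at hc
    simp at hc
  obtain ⟨c1, l1, l1'⟩ := hlam x1 _ N.in1 hd1 hle1
  obtain ⟨c2, l2, l2'⟩ := hlam x2 _ N.in2 hd2 hle2
  obtain ⟨c3, l3, -⟩ := hlam x3 _ N.in3 hd3 le_rfl
  have hz : ∀ (x y : Deriv K 3) (c c' : K), c ≠ 0 → P.lam x = Q * C c → P.lam y = Q * C c' →
      P.lam (y - (C (c' / c) : MvPolynomial (Fin 3) K) • x) = 0 := by
    intro x y c c' hc hx hy
    have h3 : (C c' : MvPolynomial (Fin 2) K) = C (c' / c) * C c := by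
      rw [← C_mul, div_mul_cancel₀ _ hc]
    rw [P.lam_sub, P.lam_smul, hx, hy, P.rho_C, h3]
    ring
  have hhom : ∀ (x y : Deriv K 3) (c c' : K) (e e' : ℕ), HomogDeriv x e → HomogDeriv y e' →
      (c' ≠ 0 → e = e') → HomogDeriv (y - (C (c' / c) : MvPolynomial (Fin 3) K) • x) e' := by
    intro x y c c' e e' hx hy he
    by_cases hc : c' = 0
    · rw [hc]; simpa using hy
    · rw [← he hc] at hy ⊢
      exact hy.sub (hx.smul (isHomogeneous_C _ _) (by omega))
  by_cases hc1 : c1 = 0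
  · by_cases hc2 : c2 = 0
    · refine bwd_final hp hH P N.in1 N.in2 hd1 hd2 (by rw [l1, hc1]; simp) (by rw [l2, hc2]; simp)
        ?_ hcard
      rw [D3']; exact mul_ne_zero hqQ hne3
    · have e2 := l2' hc2
      rw [← e2] at hd3
      refine bwd_final hp hH P (N.in1.sub (N.in2.smul _)) (N.in3.sub (N.in2.smul _))
        (hhom x2 x1 c2 c1 _ _ hd2 hd1 (fun h => by rw [l1' h, e2]))
        (hhom x2 x3 c2 c3 _ _ hd2 hd3 (fun _ => rfl))
        (hz x2 x1 c2 c1 hc2 l2 l1) (hz x2 x3 c2 c3 hc2 l2 l3) ?_ hcard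
      have h3 : D3 eulerD (x1 - (C (c1 / c2) : MvPolynomial (Fin 3) K) • x2)
          (x3 - (C (c3 / c2) : MvPolynomial (Fin 3) K) • x2) =
          - D3 eulerD x3 x1 - C (c3 / c2) * D3 eulerD x1 x2 - C (c1 / c2) * D3 eulerD x2 x3 := by
        simp only [D3, Pi.sub_apply, Pi.smul_apply, smul_eq_mul]; ring
      intro h4
      rw [h3, D1, D2, D3'] at h4
      refine N.rot.rot.indep hp (- (c3 / c2)) (- (c1 / c2)) ?_
      apply mul_left_cancel₀ hqQ
      rw [C_neg, C_neg]
      linear_combination - h4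
  · have e1 := l1' hc1
    rw [← e1] at hd3
    refine bwd_final hp hH P (N.in3.sub (N.in1.smul _)) (N.in2.sub (N.in1.smul _))
      (hhom x1 x3 c1 c3 _ _ hd1 hd3 (fun _ => rfl))
      (hhom x1 x2 c1 c2 _ _ hd1 hd2 (fun h => by rw [l2' h, e1]))
      (hz x1 x3 c1 c3 hc1 l1 l3) (hz x1 x2 c1 c2 hc1 l1 l2) ?_ hcard
    have h3 : D3 eulerD (x3 - (C (c3 / c1) : MvPolynomial (Fin 3) K) • x1)
        (x2 - (C (c2 / c1) : MvPolynomial (Fin 3) K) • x1) =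
        - D3 eulerD x2 x3 - C (c2 / c1) * D3 eulerD x3 x1 - C (c3 / c1) * D3 eulerD x1 x2 := by
      simp only [D3, Pi.sub_apply, Pi.smul_apply, smul_eq_mul]; ring
    intro h4
    rw [h3, D1, D2, D3'] at h4
    refine N.rot.indep hp (- (c2 / c1)) (- (c3 / c1)) ?_
    apply mul_left_cancel₀ hqQ
    rw [C_neg, C_neg]
    linear_combination - h4

lemma exists_NF {A : Finset (Submodule K (Fin 3 → K))} {p} (hp : Forms A p)
    {H : Submodule K (Fin 3 → K)} (hH : H ∈ A) {a0 a1 a2 a3 : Deriv K 3}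
    {f0 f1 f2 f3 : MvPolynomial (Fin 3) K} {c0 c1 c2 c3 : K} {e1 e2 e3 d : ℕ}
    (i1 : InD A a1) (i2 : InD A a2) (i3 : InD A a3)
    (gen : ∀ η, InD A η → ∃ y0 y1 y2 y3 : MvPolynomial (Fin 3) K,
      η = y0 • a0 + y1 • a1 + y2 • a2 + y3 • a3)
    (rel : f0 • a0 + f1 • a1 + f2 • a2 + f3 • a3 = 0)
    (syz : ∀ y0 y1 y2 y3 : MvPolynomial (Fin 3) K, y0 • a0 + y1 • a1 + y2 • a2 + y3 • a3 = 0 →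
      ∃ q, y0 = q * f0 ∧ y1 = q * f1 ∧ y2 = q * f2 ∧ y3 = q * f3)
    (cc0 : constantCoeff f0 = 0) (cc1 : constantCoeff f1 = 0) (cc2 : constantCoeff f2 = 0)
    (cc3 : constantCoeff f3 = 0) (ne : ¬ (f0 = 0 ∧ f1 = 0 ∧ f2 = 0 ∧ f3 = 0))
    (hE : (eulerD : Deriv K 3) = (C c0 : MvPolynomial (Fin 3) K) • a0 +
      (C c1 : MvPolynomial (Fin 3) K) • a1 + (C c2 : MvPolynomial (Fin 3) K) • a2 +
      (C c3 : MvPolynomial (Fin 3) K) • a3)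
    (hc0 : c0 ≠ 0)
    (h1 : HomogDeriv a1 e1) (h2 : HomogDeriv a2 e2) (h3 : HomogDeriv a3 e3)
    (p1 : 1 ≤ e1) (p2 : 1 ≤ e2) (p3 : 1 ≤ e3)
    (k1 : c1 ≠ 0 → e1 = 1) (k2 : c2 ≠ 0 → e2 = 1) (k3 : c3 ≠ 0 → e3 = 1)
    (hf0 : f0.IsHomogeneous (d + 1 - 1)) (hf1 : f1.IsHomogeneous (d + 1 - e1))
    (hf2 : f2.IsHomogeneous (d + 1 - e2)) (hf3 : f3.IsHomogeneous (d + 1 - e3)) :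
    ∃ x1 x2 x3 s1 s2 s3, NF A x1 x2 x3 s1 s2 s3 ∧ HomogDeriv x1 e1 ∧ HomogDeriv x2 e2 ∧
      HomogDeriv x3 e3 ∧ s1.IsHomogeneous (d + 1 - e1) ∧ s2.IsHomogeneous (d + 1 - e2) ∧
      s3.IsHomogeneous (d + 1 - e3) := by
  have hα0 : linPoly (p H) ≠ 0 := linPoly_ne (hp H hH).1
  obtain ⟨g1, hg1⟩ := (inD_iff hp a1).1 i1 H hH
  obtain ⟨g2, hg2⟩ := (inD_iff hp a2).1 i2 H hH
  obtain ⟨g3, hg3⟩ := (inD_iff hp a3).1 i3 H hH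
  have hapE : ap (p H) eulerD = linPoly (p H) := rfl
  have hz1 : ap (p H) (a1 - g1 • eulerD) = 0 := by
    rw [map_sub, map_smul, hg1, hapE, smul_eq_mul]; ring
  have hz2 : ap (p H) (a2 - g2 • eulerD) = 0 := by
    rw [map_sub, map_smul, hg2, hapE, smul_eq_mul]; ring
  have hz3 : ap (p H) (a3 - g3 • eulerD) = 0 := by
    rw [map_sub, map_smul, hg3, hapE, smul_eq_mul]; ring
  have hxh : ∀ (a : Deriv K 3) (g : MvPolynomial (Fin 3) K) (e : ℕ), HomogDeriv a e → 1 ≤ e →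
      ap (p H) a = linPoly (p H) * g → HomogDeriv (a - g • eulerD) e := by
    intro a g e ha he hg
    exact ha.sub (euler_hom.smul (hom_div (ap_hom ha) (linPoly_hom _) hα0 hg).1 (by omega))
  have hsh : ∀ (f : MvPolynomial (Fin 3) K) (c : K) (e : ℕ), f.IsHomogeneous (d + 1 - e) →
      (c ≠ 0 → e = 1) → (f - C (c / c0) * f0).IsHomogeneous (d + 1 - e) := by
    intro f c e hf he
    by_cases hc : c = 0
    · rw [hc]; simpa using hf
    · rw [he hc] at hf ⊢
      exact hf.sub (hf0.C_mul _)
  have hscc : ∀ (f : MvPolynomial (Fin 3) K) (c : K), constantCoeff f = 0 →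
      constantCoeff (f - C (c / c0) * f0) = 0 := by
    intro f c hf
    rw [map_sub, map_mul, hf, cc0]; simp
  have hxz : ∀ x y1 y2 y3 : MvPolynomial (Fin 3) K, x • eulerD + y1 • (a1 - g1 • eulerD) +
      y2 • (a2 - g2 • eulerD) + y3 • (a3 - g3 • eulerD) = 0 → x = 0 := by
    intro x y1 y2 y3 h
    have := congrArg (ap (p H)) h
    simp only [map_add, map_smul (ap (p H)), hz1, hz2, hz3, mul_zero, add_zero, hapE, map_zero,
      smul_eq_mul] at this
    exact (mul_eq_zero.1 this).resolve_right hα0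
  have hinv : (C c0⁻¹ * C c0 : MvPolynomial (Fin 3) K) = 1 := by
    rw [← C_mul, inv_mul_cancel₀ hc0, C_1]
  have hdiv : ∀ c : K, (C (c / c0) : MvPolynomial (Fin 3) K) = C c * C c0⁻¹ := fun c => by
    rw [← C_mul, div_eq_mul_inv]
  have hEj : ∀ j, (eulerD : Deriv K 3) j = C c0 * a0 j + C c1 * a1 j + C c2 * a2 j + C c3 * a3 j :=
    fun j => by conv_lhs => rw [hE]
                rfl
  have hrj : ∀ j, f0 * a0 j + f1 * a1 j + f2 * a2 j + f3 * a3 j = 0 := fun j => congrFun rel j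
  refine ⟨a1 - g1 • eulerD, a2 - g2 • eulerD, a3 - g3 • eulerD, f1 - C (c1 / c0) * f0,
    f2 - C (c2 / c0) * f0, f3 - C (c3 / c0) * f0, ⟨i1.sub ((inD_euler _).smul _),
    i2.sub ((inD_euler _).smul _), i3.sub ((inD_euler _).smul _), ?_, ?_, ?_, hscc _ _ cc1,
    hscc _ _ cc2, hscc _ _ cc3, ?_⟩, hxh _ _ _ h1 p1 hg1, hxh _ _ _ h2 p2 hg2, hxh _ _ _ h3 p3 hg3,
    hsh _ _ _ hf1 k1, hsh _ _ _ hf2 k2, hsh _ _ _ hf3 k3⟩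
  · intro η hη
    obtain ⟨y0, y1, y2, y3, hy⟩ := gen η hη
    refine ⟨y0 * C c0⁻¹ + (y1 - y0 * C (c1 / c0)) * g1 + (y2 - y0 * C (c2 / c0)) * g2 +
      (y3 - y0 * C (c3 / c0)) * g3, y1 - y0 * C (c1 / c0), y2 - y0 * C (c2 / c0),
      y3 - y0 * C (c3 / c0), ?_⟩
    funext j
    have h4 := congrFun hy j
    have h5 := hEj j
    simp only [Pi.add_apply, Pi.sub_apply, Pi.smul_apply, smul_eq_mul, hdiv] at h4 ⊢
    linear_combination h4 - y0 * C c0⁻¹ * h5 - y0 * a0 j * hinv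
  · have h0 : (f0 * C c0⁻¹ + (f1 - C (c1 / c0) * f0) * g1 + (f2 - C (c2 / c0) * f0) * g2 +
      (f3 - C (c3 / c0) * f0) * g3) • (eulerD : Deriv K 3) +
      (f1 - C (c1 / c0) * f0) • (a1 - g1 • eulerD) + (f2 - C (c2 / c0) * f0) • (a2 - g2 • eulerD) +
      (f3 - C (c3 / c0) * f0) • (a3 - g3 • eulerD) = 0 := by
      funext j
      have h4 := hrj j
      have h5 := hEj j
      simp only [Pi.add_apply, Pi.sub_apply, Pi.smul_apply, smul_eq_mul, hdiv, Pi.zero_apply]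
      linear_combination h4 + f0 * C c0⁻¹ * h5 + f0 * a0 j * hinv
    rw [hxz _ _ _ _ h0, zero_smul, zero_add] at h0
    exact h0
  · intro x y1 y2 y3 h
    have hx := hxz _ _ _ _ h
    obtain ⟨q, q0, q1, q2, q3⟩ := syz (-(y1 * g1 + y2 * g2 + y3 * g3) * C c0)
      (y1 - (y1 * g1 + y2 * g2 + y3 * g3) * C c1) (y2 - (y1 * g1 + y2 * g2 + y3 * g3) * C c2)
      (y3 - (y1 * g1 + y2 * g2 + y3 * g3) * C c3) (by
        funext j
        have h4 := congrFun h j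
        have h5 := hEj j
        simp only [Pi.add_apply, Pi.sub_apply, Pi.smul_apply, smul_eq_mul, Pi.zero_apply, hx]
          at h4 ⊢
        linear_combination h4 + (y1 * g1 + y2 * g2 + y3 * g3) * h5)
    refine ⟨q, hx, ?_, ?_, ?_⟩
    · rw [hdiv]
      linear_combination q1 - C c1 * C c0⁻¹ * q0 - (y1 * g1 + y2 * g2 + y3 * g3) * C c1 * hinv
    · rw [hdiv]
      linear_combination q2 - C c2 * C c0⁻¹ * q0 - (y1 * g1 + y2 * g2 + y3 * g3) * C c2 * hinv
    · rw [hdiv]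
      linear_combination q3 - C c3 * C c0⁻¹ * q0 - (y1 * g1 + y2 * g2 + y3 * g3) * C c3 * hinv
  · rintro ⟨z1, z2, z3⟩
    have hf00 : f0 = 0 := by
      have h6 : C c0⁻¹ * f0 * (X 0 : MvPolynomial (Fin 3) K) = 0 := by
        have h4 := hrj 0
        have h5 := hEj 0
        rw [hdiv] at z1 z2 z3
        simp only [eulerD] at h5
        linear_combination h4 - a1 0 * z1 - a2 0 * z2 - a3 0 * z3 + f0 * C c0⁻¹ * h5 +
          f0 * a0 0 * hinv
      have h7 := (mul_eq_zero.1 h6).resolve_right (X_ne_zero _)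
      exact (mul_eq_zero.1 h7).resolve_left (by simpa using hc0)
    rw [hf00, mul_zero, sub_zero] at z1 z2 z3
    exact ne ⟨hf00, z1, z2, z3⟩


lemma bwd {A : Finset (Submodule K (Fin 3 → K))} (hA : IsArrangement A)
    {H : Submodule K (Fin 3 → K)} (hH : H ∈ A) {d1 d2 d : ℕ}
    (hd : (d : ℤ) = ((restrict A H).card : ℤ) - 1) (h : IsSPOG A ![1, d1 + 1, d2 + 1] d) :
    IsFreeExp (A.erase H) ![1, d1, d2] := by
  obtain ⟨p, hp⟩ := exists_forms hA
  obtain ⟨θ, φ, f, α, ⟨hin, hφ, hθ, hφh, hgen, hα1, hf, hcc, hrel, hne, hsyz⟩, hα0⟩ := h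
  have hcα : constantCoeff α = 0 := hom_cc hα1 one_pos
  have hcard : d + 1 = (restrict A H).card := by omega
  have t0 : HomogDeriv (θ 0) 1 := hθ 0
  have t1 : HomogDeriv (θ 1) (d1 + 1) := hθ 1
  have t2 : HomogDeriv (θ 2) (d2 + 1) := hθ 2
  have u0 : (f 0).IsHomogeneous (d + 1 - 1) := hf 0
  have u1 : (f 1).IsHomogeneous (d + 1 - (d1 + 1)) := hf 1
  have u2 : (f 2).IsHomogeneous (d + 1 - (d2 + 1)) := hf 2
  have u3 : α.IsHomogeneous (d + 1 - d) := by
    have : d + 1 - d = 1 := by omega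
    rwa [this]
  have gen : ∀ η, InD A η → ∃ y0 y1 y2 y3 : MvPolynomial (Fin 3) K,
      η = y0 • θ 0 + y1 • θ 1 + y2 • θ 2 + y3 • φ := by
    intro η hη
    obtain ⟨c, g, hc⟩ := hgen η hη
    rw [Fin.sum_univ_three] at hc
    exact ⟨c 0, c 1, c 2, g, hc⟩
  have rel : f 0 • θ 0 + f 1 • θ 1 + f 2 • θ 2 + α • φ = 0 := by
    rw [Fin.sum_univ_three] at hrel
    exact hrel
  have syz : ∀ y0 y1 y2 y3 : MvPolynomial (Fin 3) K,
      y0 • θ 0 + y1 • θ 1 + y2 • θ 2 + y3 • φ = 0 →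
      ∃ q, y0 = q * f 0 ∧ y1 = q * f 1 ∧ y2 = q * f 2 ∧ y3 = q * α := by
    intro y0 y1 y2 y3 hy
    obtain ⟨q, hq, hq'⟩ := hsyz ![y0, y1, y2] y3 (by rw [Fin.sum_univ_three]; exact hy)
    exact ⟨q, hq 0, hq 1, hq 2, hq'⟩
  have hdpos : 1 ≤ d := by
    by_contra hlt
    have hd0 : d = 0 := by omega
    have z : ∀ i, f i = 0 := by
      intro i
      have h1 : d + 1 - (![1, d1 + 1, d2 + 1] : Fin 3 → ℕ) i = 0 := by
        fin_cases i <;> simp [hd0]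
      have h2 := hf i
      rw [h1] at h2
      rw [hom_zero_eq_C h2, hcc i, C_0]
    have hφ0 : φ = 0 := by
      rw [z 0, z 1, z 2, zero_smul, zero_smul, zero_smul] at rel
      funext j
      have h3 := congrFun rel j
      simp only [Pi.add_apply, Pi.smul_apply, smul_eq_mul, Pi.zero_apply, zero_add] at h3
      exact (mul_eq_zero.1 h3).resolve_left hα0
    obtain ⟨q, -, -, -, hq⟩ := syz 0 0 0 1 (by rw [hφ0]; simp)
    have h4 := congrArg constantCoeff hq
    rw [map_mul, hcα] at h4
    simp at h4
  obtain ⟨y0, y1, y2, y3, hy⟩ := gen eulerD (inD_euler _)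
  obtain ⟨c, hE, hce, i, hi⟩ := euler_coefs (θ := ![θ 0, θ 1, θ 2, φ])
    (e := ![1, d1 + 1, d2 + 1, d]) (c := ![y0, y1, y2, y3])
    (by intro i; fin_cases i; exacts [t0, t1, t2, hφh])
    (by intro i; fin_cases i <;> simp [hdpos]) (by rw [Fin.sum_univ_four]; exact hy)
  have hE' : (eulerD : Deriv K 3) = (C (c 0) : MvPolynomial (Fin 3) K) • θ 0 +
      (C (c 1) : MvPolynomial (Fin 3) K) • θ 1 + (C (c 2) : MvPolynomial (Fin 3) K) • θ 2 +
      (C (c 3) : MvPolynomial (Fin 3) K) • φ := by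
    rw [Fin.sum_univ_four] at hE
    exact hE
  have k0 : c 0 ≠ 0 → 1 = 1 := hce 0
  have k1 : c 1 ≠ 0 → d1 + 1 = 1 := hce 1
  have k2 : c 2 ≠ 0 → d2 + 1 = 1 := hce 2
  have k3 : c 3 ≠ 0 → d = 1 := hce 3
  have fin : (∃ x1 x2 x3 s1 s2 s3, NF A x1 x2 x3 s1 s2 s3 ∧ HomogDeriv x1 (d1 + 1) ∧
      HomogDeriv x2 (d2 + 1) ∧ HomogDeriv x3 d ∧ s1.IsHomogeneous (d + 1 - (d1 + 1)) ∧
      s2.IsHomogeneous (d + 1 - (d2 + 1)) ∧ s3.IsHomogeneous (d + 1 - d)) →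
      IsFreeExp (A.erase H) ![1, d1, d2] := by
    rintro ⟨x1, x2, x3, s1, s2, s3, N, a1, a2, a3, b1, b2, b3⟩
    exact bwd_core hp hH N a1 a2 a3 b1 b2 b3 hcard
  apply fin
  clear fin
  have hcase : c 0 ≠ 0 ∨ c 1 ≠ 0 ∨ c 2 ≠ 0 ∨ c 3 ≠ 0 := by
    fin_cases i
    · exact Or.inl hi
    · exact Or.inr (Or.inl hi)
    · exact Or.inr (Or.inr (Or.inl hi))
    · exact Or.inr (Or.inr (Or.inr hi))
  rcases hcase with hi | hi | hi | hi
  · exact exists_NF hp hH (hin 1) (hin 2) hφ gen rel syz (hcc 0) (hcc 1) (hcc 2) hcα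
      (fun hh => hα0 hh.2.2.2) hE' hi t1 t2 hφh (by omega) (by omega) hdpos k1 k2 k3 u0 u1 u2 u3
  · have e := k1 hi
    rw [← e] at t0
    rw [e] at u1
    refine exists_NF hp hH (a0 := θ 1) (a1 := θ 0) (f0 := f 1) (f1 := f 0) (c0 := c 1) (c1 := c 0)
      (hin 0) (hin 2) hφ ?_ (by rw [← rel]; abel) ?_ (hcc 1) (hcc 0) (hcc 2) hcα
      (fun hh => hα0 hh.2.2.2) (by rw [hE']; abel) hi t0 t2 hφh (by omega) (by omega) hdpos
      (fun _ => e) k2 k3 u1 (by rw [e]; exact u0) u2 u3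
    · intro η hη
      obtain ⟨y0, y1, y2, y3, hy⟩ := gen η hη
      exact ⟨y1, y0, y2, y3, by rw [hy]; abel⟩
    · intro y0 y1 y2 y3 hy
      obtain ⟨q, q0, q1, q2, q3⟩ := syz y1 y0 y2 y3 (by rw [← hy]; abel)
      exact ⟨q, q1, q0, q2, q3⟩
  · have e := k2 hi
    rw [← e] at t0
    rw [e] at u2
    refine exists_NF hp hH (a0 := θ 2) (a2 := θ 0) (f0 := f 2) (f2 := f 0) (c0 := c 2) (c2 := c 0)
      (hin 1) (hin 0) hφ ?_ (by rw [← rel]; abel) ?_ (hcc 2) (hcc 1) (hcc 0) hcα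
      (fun hh => hα0 hh.2.2.2) (by rw [hE']; abel) hi t1 t0 hφh (by omega) (by omega) hdpos
      k1 (fun _ => e) k3 u2 u1 (by rw [e]; exact u0) u3
    · intro η hη
      obtain ⟨y0, y1, y2, y3, hy⟩ := gen η hη
      exact ⟨y2, y1, y0, y3, by rw [hy]; abel⟩
    · intro y0 y1 y2 y3 hy
      obtain ⟨q, q0, q1, q2, q3⟩ := syz y2 y1 y0 y3 (by rw [← hy]; abel)
      exact ⟨q, q2, q1, q0, q3⟩
  · have e := k3 hi
    have t0' : HomogDeriv (θ 0) d := by rw [e]; exact t0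
    have u0' : (f 0).IsHomogeneous (d + 1 - d) := by
      have h5 : d + 1 - d = d + 1 - 1 := by omega
      rw [h5]; exact u0
    have u3' : α.IsHomogeneous (d + 1 - 1) := by
      have h5 : d + 1 - 1 = 1 := by omega
      rw [h5]; exact hα1
    refine exists_NF hp hH (a0 := φ) (a3 := θ 0) (f0 := α) (f3 := f 0) (c0 := c 3) (c3 := c 0)
      (hin 1) (hin 2) (hin 0) ?_ (by rw [← rel]; abel) ?_ hcα (hcc 1) (hcc 2) (hcc 0)
      (fun hh => hα0 hh.1) (by rw [hE']; abel) hi t1 t2 t0' (by omega) (by omega) hdpos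
      k1 k2 (fun _ => e) u3' u1 u2 u0'
    · intro η hη
      obtain ⟨y0, y1, y2, y3, hy⟩ := gen η hη
      exact ⟨y3, y1, y2, y0, by rw [hy]; abel⟩
    · intro y0 y1 y2 y3 hy
      obtain ⟨q, q0, q1, q2, q3⟩ := syz y3 y1 y2 y0 (by rw [← hy]; abel)
      exact ⟨q, q3, q1, q2, q0⟩

/-- Theorem `addNTfree`, addition version for planes: let `ℓ = 3`,
`A` not free and `H ∈ A`. Then `A' = A \ {H}` is free with exponents `(1, d₁, d₂)` iff
`A` is strictly plus-one generated with exponents `(1, d₁+1, d₂+1)` and level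
`d = |A^H| - 1`. -/
theorem plane_addition_criterion {K : Type} [Field K]
    (A : Finset (Submodule K (Fin 3 → K)))
    (hA : IsArrangement A) (hEss : Essential A) (hnf : ¬ IsFree A)
    (H : Submodule K (Fin 3 → K)) (hH : H ∈ A)
    (d1 d2 : ℕ) :
    IsFreeExp (A.erase H) ![1, d1, d2] ↔
      ∃ d : ℕ, (d : ℤ) = ((restrict A H).card : ℤ) - 1 ∧
        IsSPOG A ![1, d1 + 1, d2 + 1] d := by
  constructor
  · exact fwd hA hEss hnf hH
  · rintro ⟨d, hd, h⟩
    exact bwd hA hH hd h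

end ArrPOG
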